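/- arXiv:2304.04619 — 6 statements merged into one kernel-verified Lean document; each statement's English description precedes it below -/
import Mathlib

section
/- Let n ≥ 2, and let p_1, …, p_r be distinct primes none of which divides n. Let K = ℚ(ζ_n, √p_1, …, √p_r) ⊆ ℂ, where ζ_n is a primitive n-th root of unity. Then there is a group isomorphism Gal(K/ℚ) ≅ Gal(ℚ(ζ_n)/ℚ) × Gal(ℚ(√p_1)/ℚ) × ⋯ × Gal(ℚ(√p_r)/ℚ). -/
open IntermediateField

lemma aux_frob {R : Type*} [CommRing R] (ζ : R) (n p : ℕ) (hp : p.Prime) (hζ : ζ ^ n = 1)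
    (k : ℕ) (hk : p ^ k ≡ 1 [MOD n]) (x : R) (hx : x ∈ Algebra.adjoin ℤ ({ζ} : Set R)) :
    ∃ y ∈ Algebra.adjoin ℤ ({ζ} : Set R), x ^ p ^ k = x + p * y := by
  have hadd : ∀ x ∈ Algebra.adjoin ℤ ({ζ} : Set R), ∀ y ∈ Algebra.adjoin ℤ ({ζ} : Set R),
      ∃ r ∈ Algebra.adjoin ℤ ({ζ} : Set R), (x + y) ^ p ^ k = x ^ p ^ k + y ^ p ^ k + p * r := by
    intro x hx y hy
    obtain ⟨r, hr⟩ := exists_add_pow_prime_pow_eq (R := Algebra.adjoin ℤ ({ζ} : Set R)) hp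
      ⟨x, hx⟩ ⟨y, hy⟩ k
    refine ⟨x * y * r, mul_mem (mul_mem hx hy) r.2, ?_⟩
    have := congrArg Subtype.val hr
    push_cast at this
    rw [this]; ring
  induction hx using Algebra.adjoin_induction with
  | mem x hx =>
    rw [Set.mem_singleton_iff] at hx
    subst hx
    refine ⟨0, zero_mem _, ?_⟩
    rw [pow_eq_pow_of_modEq hk hζ]; simp
  | algebraMap a =>
    have h : (p : ℤ) ∣ a ^ p ^ k - a := by
      have := Fact.mk hp
      rw [← ZMod.intCast_eq_intCast_iff_dvd_sub]
      push_cast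
      rw [ZMod.pow_card_pow]
    obtain ⟨c, hc⟩ := h
    refine ⟨algebraMap ℤ R c, Subalgebra.algebraMap_mem _ _, ?_⟩
    have := congrArg (algebraMap ℤ R) hc
    simp only [map_sub, map_mul, map_pow, map_natCast] at this
    linear_combination this
  | add x y hx hy h1 h2 =>
    obtain ⟨u, hu, hu'⟩ := h1
    obtain ⟨v, hv, hv'⟩ := h2
    obtain ⟨r, hr, hr'⟩ := hadd x hx y hy
    exact ⟨u + v + r, add_mem (add_mem hu hv) hr, by rw [hr', hu', hv']; ring⟩
  | mul x y hx hy h1 h2 =>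
    obtain ⟨u, hu, hu'⟩ := h1
    obtain ⟨v, hv, hv'⟩ := h2
    refine ⟨u * y + x * v + p * (u * v), ?_, by rw [mul_pow, hu', hv']; ring⟩
    exact add_mem (add_mem (mul_mem hu hy) (mul_mem hx hv)) (mul_mem (natCast_mem _ _) (mul_mem hu hv))

lemma aux_cyclo {K : Type*} [Field K] [NumberField K] (n : ℕ) [NeZero n]
    [IsCyclotomicExtension {n} ℚ K] (ζ : K) (hζ : IsPrimitiveRoot ζ n)
    (p : ℕ) (hp : p.Prime) (hpn : ¬ p ∣ n) (m : ℤ) (α : K) (hα : α ^ 2 = m) (hm : (p : ℤ) ∣ m) :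
    (p : ℤ) ^ 2 ∣ m := by
  have hic := IsCyclotomicExtension.Rat.isIntegralClosure_adjoin_singleton hζ
  have hint : IsIntegral ℤ α := by
    refine IsIntegral.of_pow (n := 2) (by norm_num) ?_
    rw [hα]; exact isIntegral_algebraMap (R := ℤ) (x := m)
  obtain ⟨a, ha⟩ := hic.isIntegral_iff.1 hint
  have hαm : α ∈ Algebra.adjoin ℤ ({ζ} : Set K) := by rw [← ha]; exact a.2
  have hcop : p.Coprime n := (Nat.Prime.coprime_iff_not_dvd hp).2 hpn
  have hk0 : n.totient ≠ 0 := (Nat.totient_pos.2 (NeZero.pos n)).ne'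
  obtain ⟨y, hy, hy'⟩ := aux_frob ζ n p hp hζ.pow_eq_one n.totient
    (Nat.ModEq.pow_totient hcop) α hαm
  obtain ⟨c, rfl⟩ := hm
  have h2 : 2 ≤ p ^ n.totient := hp.two_le.trans (Nat.le_self_pow hk0 p)
  obtain ⟨e, he⟩ := Nat.exists_eq_add_of_le h2
  rw [he, pow_add, hα] at hy'
  have hp0 : (p : K) ≠ 0 := by exact_mod_cast hp.ne_zero
  obtain ⟨β, hβ, hβ'⟩ : ∃ β ∈ Algebra.adjoin ℤ ({ζ} : Set K), α = p * β := by
    refine ⟨c * α ^ e - y, sub_mem (mul_mem (intCast_mem _ _) (pow_mem hαm _)) hy, ?_⟩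
    push_cast at hy'
    linear_combination -hy'
  have hβi : IsIntegral ℤ (β ^ 2) := (hic.isIntegral_iff.2 ⟨⟨β, hβ⟩, rfl⟩).pow 2
  have hβ2 : (p : K) * β ^ 2 = c := by
    rw [hβ'] at hα
    push_cast at hα
    apply mul_left_cancel₀ hp0
    linear_combination hα
  have hq : IsIntegral ℤ ((c : ℚ) / p) := by
    rw [← isIntegral_algebraMap_iff (A := ℚ) (B := K) (algebraMap ℚ K).injective]
    convert hβi
    simp only [map_div₀, map_intCast, map_natCast]
    rw [← hβ2]; field_simp
  obtain ⟨d, hd⟩ := IsIntegrallyClosed.isIntegral_iff.1 hq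
  have hpq : (p : ℚ) ≠ 0 := by exact_mod_cast hp.ne_zero
  have : c = p * d := by
    have : (c : ℚ) = p * d := by
      simp only [algebraMap_int_eq, eq_intCast] at hd
      rw [hd]; field_simp
    exact_mod_cast this
  exact ⟨d, by rw [this]; ring⟩

lemma aux_quad (F : IntermediateField ℚ ℂ) (x : ℂ) (hx : x ^ 2 ∈ F) (y : ℂ) (hy : y ∈ adjoin F ({x} : Set ℂ)) :
    ∃ a ∈ F, ∃ b ∈ F, y = a + b * x := by
  have hint : IsIntegral F x := IsIntegral.of_pow (n := 2) (by norm_num)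
    (isIntegral_algebraMap (R := F) (x := ⟨x ^ 2, hx⟩))
  have hy' : y ∈ (adjoin F ({x} : Set ℂ)).toSubalgebra := hy
  rw [adjoin_simple_toSubalgebra_of_isAlgebraic hint.isAlgebraic] at hy'
  induction hy' using Algebra.adjoin_induction with
  | mem z hz => exact ⟨0, zero_mem _, 1, one_mem _, by simpa using hz⟩
  | algebraMap a => exact ⟨a, a.2, 0, zero_mem _, by simp⟩
  | add u v _ _ h1 h2 =>
    obtain ⟨a, ha, b, hb, rfl⟩ := h1 (by rwa [← adjoin_simple_toSubalgebra_of_isAlgebraic hint.isAlgebraic] at *)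
    obtain ⟨c, hc, d, hd, rfl⟩ := h2 (by rwa [← adjoin_simple_toSubalgebra_of_isAlgebraic hint.isAlgebraic] at *)
    exact ⟨a + c, add_mem ha hc, b + d, add_mem hb hd, by ring⟩
  | mul u v _ _ h1 h2 =>
    obtain ⟨a, ha, b, hb, rfl⟩ := h1 (by rwa [← adjoin_simple_toSubalgebra_of_isAlgebraic hint.isAlgebraic] at *)
    obtain ⟨c, hc, d, hd, rfl⟩ := h2 (by rwa [← adjoin_simple_toSubalgebra_of_isAlgebraic hint.isAlgebraic] at *)
    exact ⟨a * c + b * d * x ^ 2, add_mem (mul_mem ha hc) (mul_mem (mul_mem hb hd) hx),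
      a * d + b * c, add_mem (mul_mem ha hd) (mul_mem hb hc), by ring⟩

lemma aux_finrank (F : IntermediateField ℚ ℂ) (x : ℂ) (hx : x ^ 2 ∈ F) (hxF : x ∉ F) :
    Module.finrank F (adjoin F ({x} : Set ℂ)) = 2 := by
  have hint : IsIntegral F x := IsIntegral.of_pow (n := 2) (by norm_num)
    (isIntegral_algebraMap (R := F) (x := ⟨x ^ 2, hx⟩))
  rw [adjoin.finrank hint]
  have hirr : Irreducible (Polynomial.X ^ 2 - Polynomial.C (⟨x ^ 2, hx⟩ : F)) := by
    apply X_pow_sub_C_irreducible_of_prime Nat.prime_two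
    intro b hb
    have hb' : (b : ℂ) ^ 2 = x ^ 2 := congrArg Subtype.val hb
    rcases sq_eq_sq_iff_eq_or_eq_neg.1 hb' with h | h
    · exact hxF (h ▸ b.2)
    · exact hxF (by rw [← neg_neg x, ← h]; exact neg_mem b.2)
  rw [← minpoly.eq_of_irreducible_of_monic hirr _ (Polynomial.monic_X_pow_sub_C _ (by norm_num))]
  · exact Polynomial.natDegree_X_pow_sub_C
  · simp [IntermediateField.algebraMap_apply]

lemma aux_step (A : Set ℂ) (x : ℂ) :
    (adjoin (adjoin ℚ A) ({x} : Set ℂ)).restrictScalars ℚ = adjoin ℚ (insert x A) := by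
  rw [← Set.union_singleton]
  exact adjoin_adjoin_left ℚ A {x}

lemma aux_indep {ι : Type*} [DecidableEq ι] (B : Set ℂ) (s : ι → ℂ)
    (hs : ∀ i, s i ^ 2 ∈ adjoin ℚ B)
    (h0 : ∀ T : Finset ι, T.Nonempty → ∏ i ∈ T, s i ∉ adjoin ℚ B) (S : Finset ι) :
    ∀ T : Finset ι, T.Nonempty → Disjoint S T → ∏ i ∈ T, s i ∉ adjoin ℚ (B ∪ s '' S) := by
  induction S using Finset.induction_on with
  | empty => intro T hT _; simpa using h0 T hT
  | insert j S hj ih =>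
    intro T hT hd hmem
    rw [Finset.disjoint_insert_left] at hd
    have hle : adjoin ℚ B ≤ adjoin ℚ (B ∪ s '' S) := adjoin.mono _ _ _ Set.subset_union_left
    rw [Finset.coe_insert, Set.image_insert_eq, Set.union_insert, ← aux_step] at hmem
    obtain ⟨a, ha, b, hb, hab⟩ := aux_quad _ _ (hle (hs j)) _ hmem
    have hT2 : (∏ i ∈ T, s i) ^ 2 ∈ adjoin ℚ (B ∪ s '' S) := by
      rw [← Finset.prod_pow]; exact prod_mem fun i _ => hle (hs i)
    have hjn : s j ∉ adjoin ℚ (B ∪ s '' S) := by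
      simpa using ih {j} (by simp) (by simpa using hj)
    have hab0 : a * b = 0 := by
      by_contra hne
      apply hjn
      have : s j = ((∏ i ∈ T, s i) ^ 2 - a ^ 2 - b ^ 2 * s j ^ 2) / (2 * (a * b)) := by
        rw [eq_div_iff (by simpa using hne), hab]; ring
      rw [this]
      exact div_mem (sub_mem (sub_mem hT2 (pow_mem ha 2)) (mul_mem (pow_mem hb 2) (hle (hs j))))
        (mul_mem (ofNat_mem _ 2) (mul_mem ha hb))
    rcases mul_eq_zero.1 hab0 with rfl | rfl
    · apply ih (insert j T) (by simp) (Finset.disjoint_insert_right.2 ⟨hj, hd.2⟩)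
      rw [Finset.prod_insert hd.1, hab]
      have : s j * (0 + b * s j) = b * s j ^ 2 := by ring
      rw [this]; exact mul_mem hb (hle (hs j))
    · apply ih T hT hd.2
      rw [hab]; simpa using ha

lemma aux_degree {ι : Type*} [DecidableEq ι] (B : Set ℂ) (s : ι → ℂ)
    (hs : ∀ i, s i ^ 2 ∈ adjoin ℚ B)
    (h0 : ∀ T : Finset ι, T.Nonempty → ∏ i ∈ T, s i ∉ adjoin ℚ B) (S : Finset ι) :
    Module.finrank ℚ (adjoin ℚ (B ∪ s '' S)) = Module.finrank ℚ (adjoin ℚ B) * 2 ^ S.card := by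
  induction S using Finset.induction_on with
  | empty => rw [Finset.coe_empty, Set.image_empty, Set.union_empty]; simp
  | insert j S hj ih =>
    have hle : adjoin ℚ B ≤ adjoin ℚ (B ∪ s '' S) := adjoin.mono _ _ _ Set.subset_union_left
    have hjn : s j ∉ adjoin ℚ (B ∪ s '' S) := by
      simpa using aux_indep B s hs h0 S {j} (by simp) (by simpa using hj)
    rw [Finset.coe_insert, Set.image_insert_eq, Set.union_insert, ← aux_step,
      Finset.card_insert_of_notMem hj, pow_succ, ← mul_assoc, ← ih,
      ← aux_finrank _ _ (hle (hs j)) hjn]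
    exact (Module.finrank_mul_finrank ℚ (adjoin ℚ (B ∪ s '' S))
      (adjoin (adjoin ℚ (B ∪ s '' S)) ({s j} : Set ℂ))).symm

noncomputable def auxRes (E F : IntermediateField ℚ ℂ) (h : F ≤ E) [Normal ℚ F] :
    (E ≃ₐ[ℚ] E) →* (F ≃ₐ[ℚ] F) :=
  letI : Algebra F E := (inclusion h).toAlgebra
  haveI : IsScalarTower ℚ F E := IsScalarTower.of_algebraMap_eq fun _ => rfl
  AlgEquiv.restrictNormalHom F

lemma auxRes_apply (E F : IntermediateField ℚ ℂ) (h : F ≤ E) [Normal ℚ F] (σ : E ≃ₐ[ℚ] E)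
    (x : F) : inclusion h (auxRes E F h σ x) = σ (inclusion h x) := by
  letI : Algebra F E := (inclusion h).toAlgebra
  haveI : IsScalarTower ℚ F E := IsScalarTower.of_algebraMap_eq fun _ => rfl
  exact AlgEquiv.restrictNormal_commutes σ F x

lemma aux_iso {ι : Type*} [Fintype ι] (A : Set ℂ) (F0 : IntermediateField ℚ ℂ)
    (F : ι → IntermediateField ℚ ℂ) [hF0 : Normal ℚ F0] [hF : ∀ i, Normal ℚ (F i)]
    [FiniteDimensional ℚ F0] [∀ i, FiniteDimensional ℚ (F i)]
    (h0 : F0 ≤ adjoin ℚ A) (h : ∀ i, F i ≤ adjoin ℚ A) (hA : ∀ x ∈ A, x ∈ F0 ∨ ∃ i, x ∈ F i)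
    (hd : Module.finrank ℚ (adjoin ℚ A) = Module.finrank ℚ F0 * ∏ i, Module.finrank ℚ (F i)) :
    Nonempty ((adjoin ℚ A ≃ₐ[ℚ] adjoin ℚ A) ≃* (F0 ≃ₐ[ℚ] F0) × (∀ i, F i ≃ₐ[ℚ] F i)) := by
  have hE : adjoin ℚ A = F0 ⊔ ⨆ i, F i := by
    apply le_antisymm
    · rw [adjoin_le_iff]
      intro x hx
      rcases hA x hx with hx | ⟨i, hx⟩
      · exact (le_sup_left : F0 ≤ _) hx
      · exact ((le_iSup F i).trans le_sup_right : F i ≤ F0 ⊔ ⨆ i, F i) hx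
    · exact sup_le h0 (iSup_le h)
  have hN : Normal ℚ (adjoin ℚ A) := by 
    rw [hE]
    exact @IntermediateField.normal_sup ℚ ℂ _ _ _ F0 (⨆ i, F i) hF0
      (@IntermediateField.normal_iSup ℚ ℂ _ _ _ ι F hF)
  have hfd : FiniteDimensional ℚ (adjoin ℚ A) := by
    apply Module.finite_of_finrank_pos
    rw [hd]
    exact Nat.mul_pos Module.finrank_pos (Finset.prod_pos fun i _ => Module.finrank_pos)
  have g0 : IsGalois ℚ F0 := ⟨⟩
  have gi : ∀ i, IsGalois ℚ (F i) := fun i => ⟨⟩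
  have gE : IsGalois ℚ (adjoin ℚ A) := ⟨⟩
  let φ : (adjoin ℚ A ≃ₐ[ℚ] adjoin ℚ A) →* (F0 ≃ₐ[ℚ] F0) × (∀ i, F i ≃ₐ[ℚ] F i) :=
    (auxRes _ F0 h0).prod (MonoidHom.pi fun i => auxRes _ (F i) (h i))
  have hinj : Function.Injective φ := by
    rw [injective_iff_map_eq_one]
    intro σ hσ
    have hσ0 : auxRes _ F0 h0 σ = 1 := congrArg Prod.fst hσ
    have hσi : ∀ i, auxRes _ (F i) (h i) σ = 1 := fun i => congrFun (congrArg Prod.snd hσ) i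
    have : (σ : adjoin ℚ A →ₐ[ℚ] adjoin ℚ A) = AlgHom.id ℚ _ := by
      apply IntermediateField.algHom_ext_of_eq_adjoin ℚ rfl
      intro x hx
      rcases hA x hx with hx | ⟨i, hx⟩
      · have := auxRes_apply _ F0 h0 σ ⟨x, hx⟩
        rw [hσ0] at this
        exact this.symm
      · have := auxRes_apply _ (F i) (h i) σ ⟨x, hx⟩
        rw [hσi] at this
        exact this.symm
    ext1 x
    exact DFunLike.congr_fun this x
  have hcard : Nat.card (adjoin ℚ A ≃ₐ[ℚ] adjoin ℚ A) =
      Nat.card ((F0 ≃ₐ[ℚ] F0) × (∀ i, F i ≃ₐ[ℚ] F i)) := by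
    rw [Nat.card_prod, Nat.card_pi, IsGalois.card_aut_eq_finrank, IsGalois.card_aut_eq_finrank, hd]
    simp_rw [IsGalois.card_aut_eq_finrank]
  have hbij : Function.Bijective φ := (Nat.bijective_iff_injective_and_card φ).2 ⟨hinj, hcard⟩
  exact ⟨MulEquiv.ofBijective φ hbij⟩

lemma aux_normal_quad (x : ℂ) (q : ℚ) (hx : x ^ 2 = q) : Normal ℚ (adjoin ℚ ({x} : Set ℂ)) := by
  have hint : IsIntegral ℚ x := IsIntegral.of_pow (n := 2) (by norm_num)
    (by rw [hx]; exact isIntegral_algebraMap (R := ℚ) (x := q))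
  have : (adjoin ℚ ({x} : Set ℂ)) = adjoin ℚ ((Polynomial.X ^ 2 - Polynomial.C q).rootSet ℂ) := by
    have hne : (Polynomial.X ^ 2 - Polynomial.C q : Polynomial ℚ) ≠ 0 :=
      (Polynomial.monic_X_pow_sub_C _ (by norm_num)).ne_zero
    apply le_antisymm
    · rw [adjoin_simple_le_iff]
      apply subset_adjoin
      rw [Polynomial.mem_rootSet]
      exact ⟨hne, by simp [hx]⟩
    · rw [adjoin_le_iff]
      intro y hy
      rw [Polynomial.mem_rootSet] at hy
      have h2 : y ^ 2 = x ^ 2 := by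
        have := hy.2
        simp only [map_sub, map_pow, Polynomial.aeval_X, Polynomial.aeval_C] at this
        rw [hx]; simpa [sub_eq_zero] using this
      rcases sq_eq_sq_iff_eq_or_eq_neg.1 h2 with rfl | rfl
      · exact mem_adjoin_simple_self _ _
      · exact neg_mem (mem_adjoin_simple_self _ _)
  rw [this]
  have := adjoin_rootSet_isSplittingField (L := ℂ)
    (p := Polynomial.X ^ 2 - Polynomial.C q) (IsAlgClosed.splits _)
  exact Normal.of_isSplittingField (hFEp := this) (Polynomial.X ^ 2 - Polynomial.C q)

set_option synthInstance.maxHeartbeats 1000000 in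
set_option maxHeartbeats 1000000 in
theorem galois_group_cyclo_multiquadratic (n : ℕ) (hn : 2 ≤ n)
    (r : ℕ) (p : Fin r → ℕ) (hp : ∀ i, Nat.Prime (p i))
    (hinj : Function.Injective p) (hnd : ∀ i, ¬ (p i ∣ n))
    (ζ : ℂ) (hζ : IsPrimitiveRoot ζ n) :
    Nonempty
      ((IntermediateField.adjoin ℚ
          (({ζ} ∪ Set.range fun i => ((Real.sqrt (p i) : ℝ) : ℂ)) : Set ℂ) ≃ₐ[ℚ]
        IntermediateField.adjoin ℚ
          (({ζ} ∪ Set.range fun i => ((Real.sqrt (p i) : ℝ) : ℂ)) : Set ℂ)) ≃*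
       ((IntermediateField.adjoin ℚ ({ζ} : Set ℂ) ≃ₐ[ℚ]
           IntermediateField.adjoin ℚ ({ζ} : Set ℂ)) ×
        (∀ i, IntermediateField.adjoin ℚ ({((Real.sqrt (p i) : ℝ) : ℂ)} : Set ℂ) ≃ₐ[ℚ]
           IntermediateField.adjoin ℚ ({((Real.sqrt (p i) : ℝ) : ℂ)} : Set ℂ)))) := by
  have : NeZero n := ⟨by omega⟩
  have hsq : ∀ i, ((Real.sqrt (p i) : ℝ) : ℂ) ^ 2 = (p i : ℂ) := by
    intro i
    rw [← Complex.ofReal_pow, Real.sq_sqrt (Nat.cast_nonneg _)]; simp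
  have hζi : IsIntegral ℚ ζ := (hζ.isIntegral (NeZero.pos n)).tower_top
  have hsi : ∀ i, IsIntegral ℚ ((Real.sqrt (p i) : ℝ) : ℂ) := fun i =>
    IsIntegral.of_pow (n := 2) (by norm_num) (by
      rw [hsq]; exact_mod_cast isIntegral_algebraMap (R := ℚ) (A := ℂ) (x := (p i : ℚ)))
  have hcyc : IsCyclotomicExtension {n} ℚ (adjoin ℚ ({ζ} : Set ℂ)) := by
    change IsCyclotomicExtension {n} ℚ (adjoin ℚ {ζ}).toSubalgebra
    rw [adjoin_simple_toSubalgebra_of_isAlgebraic hζi.isAlgebraic]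
    exact hζ.adjoin_isCyclotomicExtension ℚ
  have hf0 : FiniteDimensional ℚ (adjoin ℚ ({ζ} : Set ℂ)) := adjoin.finiteDimensional hζi
  have hfi : ∀ i, FiniteDimensional ℚ (adjoin ℚ ({((Real.sqrt (p i) : ℝ) : ℂ)} : Set ℂ)) :=
    fun i => adjoin.finiteDimensional (hsi i)
  have hnf : NumberField (adjoin ℚ ({ζ} : Set ℂ)) := { }
  have hN0 : Normal ℚ (adjoin ℚ ({ζ} : Set ℂ)) := (IsCyclotomicExtension.isGalois {n} ℚ _).to_normal
  have hNi : ∀ i, Normal ℚ (adjoin ℚ ({((Real.sqrt (p i) : ℝ) : ℂ)} : Set ℂ)) :=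
    fun i => aux_normal_quad _ (p i) (by rw [hsq]; simp)
  have hs0 : ∀ i, ((Real.sqrt (p i) : ℝ) : ℂ) ≠ 0 := by
    intro i h
    have := hsq i
    rw [h] at this
    exact (hp i).ne_zero (by exact_mod_cast (by simpa using this.symm : (p i : ℂ) = 0))
  have key : ∀ B : Set ℂ, adjoin ℚ B ≤ adjoin ℚ ({ζ} : Set ℂ) →
      ∀ T : Finset (Fin r), T.Nonempty → ∏ i ∈ T, ((Real.sqrt (p i) : ℝ) : ℂ) ∉ adjoin ℚ B := by
    intro B hB T hT hmem
    obtain ⟨j, hj⟩ := hT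
    have hdiv := aux_cyclo n (⟨ζ, mem_adjoin_simple_self ℚ ζ⟩ : adjoin ℚ ({ζ} : Set ℂ))
      (IsPrimitiveRoot.coe_submonoidClass_iff.1 hζ) (p j) (hp j) (hnd j) (∏ i ∈ T, (p i : ℤ))
      ⟨_, hB hmem⟩ (by
        apply Subtype.ext
        push_cast
        rw [← Finset.prod_pow]
        exact Finset.prod_congr rfl fun i _ => hsq i)
      (Finset.dvd_prod_of_mem _ hj)
    have hdiv' : p j ^ 2 ∣ ∏ i ∈ T, p i := by exact_mod_cast hdiv
    rw [← Finset.mul_prod_erase T p hj, sq] at hdiv'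
    have := Nat.dvd_of_mul_dvd_mul_left (hp j).pos hdiv'
    obtain ⟨i, hi, hi'⟩ := (Prime.dvd_finsetProd_iff (hp j).prime _).1 this
    have := (Nat.prime_dvd_prime_iff_eq (hp j) (hp i)).1 hi'
    exact (Finset.mem_erase.1 hi).1 (hinj this).symm
  have hdeg := aux_degree ({ζ} : Set ℂ) (fun i => ((Real.sqrt (p i) : ℝ) : ℂ))
    (fun i => by simp only [hsq]; exact _root_.natCast_mem _ _) (key _ le_rfl) Finset.univ
  have hdi : ∀ i, Module.finrank ℚ (adjoin ℚ ({((Real.sqrt (p i) : ℝ) : ℂ)} : Set ℂ)) = 2 := by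
    intro i
    have := aux_degree (∅ : Set ℂ) (fun i => ((Real.sqrt (p i) : ℝ) : ℂ))
      (fun i => by simp only [hsq]; exact _root_.natCast_mem _ _)
      (key _ (adjoin.mono _ _ _ (Set.empty_subset _))) {i}
    rw [Finset.coe_singleton, Set.image_singleton, Set.empty_union, adjoin_empty] at this
    simpa using this
  refine aux_iso _ _ _ (adjoin.mono _ _ _ Set.subset_union_left)
    (fun i => adjoin.mono _ _ _ ?_) ?_ ?_
  · rw [Set.singleton_subset_iff]
    exact Or.inr ⟨i, rfl⟩
  · rintro x (hx | ⟨i, rfl⟩)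
    · exact Or.inl (subset_adjoin _ _ hx)
    · exact Or.inr ⟨i, mem_adjoin_simple_self _ _⟩
  · rw [Finset.coe_univ, Set.image_univ] at hdeg
    rw [hdeg]
    simp [hdi]
end

section
/- Let n ≥ 2, let ω(n) denote the number of distinct primes dividing n, and let p_1, …, p_r be distinct primes none of which divides n. Let TV_K := TV_{K_n} ⊗ V_{p_1} ⊗ ⋯ ⊗ V_{p_r}. Then Cond(TV_K) ≤ φ(n) · 2^{ω(n)/2} · ∏_{i=1}^r (2 + √p_i). -/
open scoped Kronecker

/-- The Frobenius norm of a complex matrix: `√(∑_{i,j} |A_{ij}|²)`. -/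
noncomputable def frobNorm {m n : Type*} [Fintype m] [Fintype n]
    (A : Matrix m n ℂ) : ℝ :=
  Real.sqrt (∑ i, ∑ j, ‖A i j‖ ^ 2)

/-- The condition number `Cond(A) = ‖A‖ · ‖A⁻¹‖` (Frobenius norm). -/
noncomputable def condNum {n : Type*} [Fintype n] [DecidableEq n]
    (A : Matrix n n ℂ) : ℝ :=
  frobNorm A * frobNorm A⁻¹

/-- The iterated Kronecker product of the matrices `V i`, realized on the
canonical index set `∀ i, Fin (t i)`: its `(f, g)` entry is `∏ i, (V i) (f i) (g i)`. -/
noncomputable def kronProd {r : ℕ} {t : Fin r → ℕ}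
    (V : ∀ i, Matrix (Fin (t i)) (Fin (t i)) ℂ) :
    Matrix (∀ i, Fin (t i)) (∀ i, Fin (t i)) ℂ :=
  Matrix.of fun f g => ∏ i, V i (f i) (g i)

/-- The matrix `V_p`: `[[1, √p],[1, −√p]]` if `p ≡ 2, 3 (mod 4)`, and
`[[1, (1+√p)/2],[1, (1−√p)/2]]` if `p ≡ 1 (mod 4)`. -/
noncomputable def Vp (p : ℕ) : Matrix (Fin 2) (Fin 2) ℝ :=
  if p % 4 = 1 then
    !![1, (1 + Real.sqrt p) / 2; 1, (1 - Real.sqrt p) / 2]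
  else
    !![1, Real.sqrt p; 1, -Real.sqrt p]

lemma sum_nthRoots_aux {m : ℕ} (hm : 0 < m) {c b : ℕ} (hc : c < m) (hb : b < m) :
    ∑ x ∈ Polynomial.nthRootsFinset m (1 : ℂ), x ^ c * (x⁻¹) ^ b = if c = b then (m : ℂ) else 0 := by
  have : NeZero m := ⟨hm.ne'⟩
  obtain ⟨μ, hμ⟩ : ∃ μ : ℂ, IsPrimitiveRoot μ m := ⟨_, Complex.isPrimitiveRoot_exp m hm.ne'⟩
  have hμ0 : μ ≠ 0 := hμ.ne_zero hm.ne'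
  have h1 : ∑ x ∈ Polynomial.nthRootsFinset m (1 : ℂ), x ^ c * (x⁻¹) ^ b
      = ∑ i ∈ Finset.range m, (μ ^ c * (μ⁻¹) ^ b) ^ i := by
    symm
    refine Finset.sum_bij (fun i _ => μ ^ i) ?_ ?_ ?_ ?_
    · intro i _
      rw [Polynomial.mem_nthRootsFinset hm, ← pow_mul, mul_comm, pow_mul, hμ.pow_eq_one, one_pow]
    · intro i hi j hj h
      exact hμ.pow_inj (Finset.mem_range.1 hi) (Finset.mem_range.1 hj) h
    · intro x hx
      rw [Polynomial.mem_nthRootsFinset hm] at hx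
      obtain ⟨i, hi, rfl⟩ := hμ.eq_pow_of_pow_eq_one hx
      exact ⟨i, Finset.mem_range.2 hi, rfl⟩
    · intro i _
      rw [mul_pow, ← pow_mul, ← pow_mul, ← inv_pow, ← pow_mul, ← pow_mul, mul_comm c, mul_comm b]
  rw [h1]
  split_ifs with h
  · subst h
    rw [← mul_pow, mul_inv_cancel₀ hμ0]
    simp
  · have hne : μ ^ c * (μ⁻¹) ^ b ≠ 1 := by
      intro h2
      rw [inv_pow, mul_inv_eq_one₀ (pow_ne_zero _ hμ0)] at h2
      exact h (hμ.pow_inj hc hb h2)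
    rw [geom_sum_eq hne, mul_pow, ← pow_mul, ← pow_mul, mul_comm c, mul_comm b, pow_mul, pow_mul,
      inv_pow, hμ.pow_eq_one]
    simp

lemma cyc_bound (q k : ℕ) (hq : q.Prime) (hk : 1 ≤ k)
    (ζ : Fin (q ^ k).totient → ℂ) (hζ : ∀ a, IsPrimitiveRoot (ζ a) (q ^ k))
    (hinj : Function.Injective ζ) :
    ∃ W : Matrix (Fin (q ^ k).totient) (Fin (q ^ k).totient) ℂ,
      W * (Matrix.of fun a b : Fin (q ^ k).totient => ζ a ^ (b : ℕ)) = 1 ∧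
      frobNorm (Matrix.of fun a b : Fin (q ^ k).totient => ζ a ^ (b : ℕ)) * frobNorm W
        ≤ (q ^ k).totient * Real.sqrt 2 := by
  obtain ⟨l, rfl⟩ : ∃ l, k = l + 1 := ⟨k - 1, by omega⟩
  have ht : (q ^ (l + 1)).totient = q ^ l * (q - 1) := Nat.totient_prime_pow_succ hq l
  have hQ : 0 < q ^ l := pow_pos hq.pos l
  have hmQ : q ^ (l + 1) = q ^ l * (q - 1) + q ^ l := by
    obtain ⟨d, rfl⟩ : ∃ d, q = d + 1 := ⟨q - 1, by have := hq.pos; omega⟩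
    simp only [Nat.add_sub_cancel]; ring
  have hm0 : 0 < q ^ (l + 1) := pow_pos hq.pos _
  have hvan : ∀ x ∈ Polynomial.nthRootsFinset (q ^ (l + 1)) (1 : ℂ),
      x ∉ primitiveRoots (q ^ (l + 1)) ℂ → x ^ (q ^ l) = 1 := by
    intro x hx hx'
    rw [Polynomial.mem_nthRootsFinset hm0] at hx
    rw [mem_primitiveRoots hm0] at hx'
    have hd := orderOf_dvd_of_pow_eq_one hx
    obtain ⟨i, hi, h⟩ := (Nat.dvd_prime_pow hq).1 hd
    have : i ≠ l + 1 := by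
      rintro rfl
      exact hx' (h ▸ IsPrimitiveRoot.orderOf x)
    rw [← orderOf_dvd_iff_pow_eq_one, h]
    exact pow_dvd_pow q (by omega)
  have himg : ∀ f : ℂ → ℂ, (∀ x : ℂ, x ^ (q ^ l) = 1 → f x = 0) →
      ∑ a, f (ζ a) = ∑ x ∈ Polynomial.nthRootsFinset (q ^ (l + 1)) (1 : ℂ), f x := by
    intro f hf
    have h1 : Finset.univ.image ζ = primitiveRoots (q ^ (l + 1)) ℂ := by
      apply Finset.eq_of_subset_of_card_le
      · intro x hx
        obtain ⟨a, _, rfl⟩ := Finset.mem_image.1 hx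
        exact (mem_primitiveRoots hm0).2 (hζ a)
      · rw [Finset.card_image_of_injective _ hinj, Complex.card_primitiveRoots]
        simp
    have h2 : ∑ a, f (ζ a) = ∑ x ∈ primitiveRoots (q ^ (l + 1)) ℂ, f x := by
      rw [← h1, Finset.sum_image (fun a _ b _ h => hinj h)]
    rw [h2]
    apply Finset.sum_subset
    · intro x hx
      rw [mem_primitiveRoots hm0] at hx
      rw [Polynomial.mem_nthRootsFinset hm0]
      exact hx.pow_eq_one
    · intro x hx hx'
      exact hf x (hvan x hx hx')
  generalize hmdef : q ^ (l + 1) = m at *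
  generalize hQdef : q ^ l = Q at *
  -- the companion exponent
  have key : ∀ b : ℕ, b < m.totient → ∃ b' : ℕ, b' < m ∧ m.totient ≤ b' ∧
      ∀ x : ℂ, x ^ Q = 1 → (x ^ b = x ^ b') := by
    intro b hb
    refine ⟨b % Q + Q * (q - 1), ?_, ?_, ?_⟩
    · have := Nat.mod_lt b hQ
      omega
    · omega
    · intro x hx
      have : x ^ b = x ^ (b % Q) := by
        conv_lhs => rw [← Nat.mod_add_div b Q]
        rw [pow_add, pow_mul, hx, one_pow, mul_one]
      rw [this, pow_add, pow_mul, hx, one_pow, mul_one]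
  choose! B hB1 hB2 hB3 using key
  have hm' : (m : ℂ) ≠ 0 := by exact_mod_cast hm0.ne'
  have htm : m.totient ≤ m := Nat.totient_le m
  refine ⟨Matrix.of fun b a => ((ζ a)⁻¹ ^ (b : ℕ) - (ζ a)⁻¹ ^ (B b)) / m, ?_, ?_⟩
  · ext b c
    rw [Matrix.mul_apply]
    simp only [Matrix.of_apply]
    rw [himg (fun x => (x⁻¹ ^ (b : ℕ) - x⁻¹ ^ (B b)) / m * x ^ (c : ℕ))]
    · have e : ∀ x : ℂ, (x⁻¹ ^ (b : ℕ) - x⁻¹ ^ (B b)) / m * x ^ (c : ℕ)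
          = (x ^ (c : ℕ) * x⁻¹ ^ (b : ℕ) - x ^ (c : ℕ) * x⁻¹ ^ (B b)) / m := by
        intro x; ring
      simp only [e]
      have hb := hB1 b b.2
      have hb2 := hB2 b b.2
      have hcl := c.2
      have hbl := b.2
      rw [← Finset.sum_div, Finset.sum_sub_distrib, sum_nthRoots_aux hm0 (by omega) (by omega),
        sum_nthRoots_aux hm0 (by omega) hb, if_neg (by omega : ¬ (c : ℕ) = B b), Matrix.one_apply]
      by_cases h : b = c
      · subst h; simp [hm']
      · have : (c : ℕ) ≠ b := fun h' => h (Fin.ext h'.symm)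
        simp [h, this]
    · intro x hx
      rw [hB3 b b.2 x⁻¹ (by rw [inv_pow, hx, inv_one])]
      simp
  · have hnorm : ∀ a, ‖ζ a‖ = 1 := fun a => (hζ a).norm'_eq_one hm0.ne'
    have hF : frobNorm (Matrix.of fun a b : Fin m.totient => ζ a ^ (b : ℕ)) = m.totient := by
      unfold frobNorm
      simp [hnorm, ← sq]
    rw [hF]
    apply mul_le_mul_of_nonneg_left _ (Nat.cast_nonneg _)
    unfold frobNorm
    apply Real.sqrt_le_sqrt
    have hrow : ∀ b : Fin m.totient, ∑ a, ‖((ζ a)⁻¹ ^ (b : ℕ) - (ζ a)⁻¹ ^ (B b)) / (m : ℂ)‖ ^ 2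
        = 2 / m := by
      intro b
      have hb := hB1 b b.2
      have hb2 := hB2 b b.2
      have hbl := b.2
      have hconj : ∀ a, (starRingEnd ℂ) (ζ a) = (ζ a)⁻¹ := by
        intro a
        rw [Complex.inv_eq_conj (hnorm a)]
      have e1 : ∀ a, ((‖((ζ a)⁻¹ ^ (b : ℕ) - (ζ a)⁻¹ ^ (B b)) / (m : ℂ)‖ ^ 2 : ℝ) : ℂ)
          = (fun x : ℂ => (x⁻¹ ^ (b : ℕ) - x⁻¹ ^ (B b)) * (x ^ (b : ℕ) - x ^ (B b)) / (m : ℂ) ^ 2)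
            (ζ a) := by
        intro a
        push_cast
        rw [← Complex.mul_conj']
        simp only [map_div₀, map_sub, map_pow, map_inv₀, hconj, inv_inv, Complex.conj_natCast]
        ring
      have : ((∑ a, ‖((ζ a)⁻¹ ^ (b : ℕ) - (ζ a)⁻¹ ^ (B b)) / (m : ℂ)‖ ^ 2 : ℝ) : ℂ)
          = ((2 / m : ℝ) : ℂ) := by
        rw [Complex.ofReal_sum]
        simp only [e1]
        rw [himg (fun x : ℂ =>
          (x⁻¹ ^ (b : ℕ) - x⁻¹ ^ (B b)) * (x ^ (b : ℕ) - x ^ (B b)) / (m : ℂ) ^ 2)]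
        · have e : ∀ x : ℂ,
            (x⁻¹ ^ (b : ℕ) - x⁻¹ ^ (B b)) * (x ^ (b : ℕ) - x ^ (B b)) / (m : ℂ) ^ 2
            = (x ^ (b : ℕ) * x⁻¹ ^ (b : ℕ) - x ^ (B b) * x⁻¹ ^ (b : ℕ)
              - x ^ (b : ℕ) * x⁻¹ ^ (B b) + x ^ (B b) * x⁻¹ ^ (B b)) / (m : ℂ) ^ 2 := by
            intro x; ring
          simp only [e]
          rw [← Finset.sum_div, Finset.sum_add_distrib, Finset.sum_sub_distrib,
            Finset.sum_sub_distrib,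
            sum_nthRoots_aux hm0 (by omega) (by omega), sum_nthRoots_aux hm0 (by omega) (by omega),
            sum_nthRoots_aux hm0 (by omega) (by omega), sum_nthRoots_aux hm0 (by omega) (by omega),
            if_pos rfl, if_pos rfl, if_neg (by omega), if_neg (by omega)]
          push_cast
          field_simp
          ring
        · intro x hx
          rw [hB3 b b.2 x hx]
          simp
      exact_mod_cast this
    simp only [Matrix.of_apply]
    rw [Finset.sum_congr rfl (fun b _ => hrow b)]
    have hmr : (0 : ℝ) < m := by exact_mod_cast hm0
    have htmr : (m.totient : ℝ) ≤ m := by exact_mod_cast htm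
    simp only [Finset.sum_const, Finset.card_univ, Fintype.card_fin, nsmul_eq_mul]
    rw [mul_div_assoc', div_le_iff₀ hmr]
    linarith

lemma Vp_bound (p : ℕ) (hp : p.Prime) :
    ∃ W : Matrix (Fin 2) (Fin 2) ℂ, W * (Vp p).map Complex.ofReal = 1 ∧
      frobNorm ((Vp p).map Complex.ofReal) * frobNorm W ≤ 2 + Real.sqrt p := by
  have h1 : (1 : ℝ) ≤ p := by exact_mod_cast hp.one_lt.le
  obtain ⟨x, hx⟩ : ∃ x, x = Real.sqrt p := ⟨_, rfl⟩
  have hx1 : 1 ≤ x := by rw [hx]; exact Real.one_le_sqrt.2 h1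
  have hx0 : 0 < x := by linarith
  have hxc : (x : ℂ) ≠ 0 := by exact_mod_cast hx0.ne'
  by_cases h : p % 4 = 1
  · have hV : (Vp p).map Complex.ofReal
        = !![((1 : ℝ) : ℂ), ((1 + x) / 2 : ℝ); ((1 : ℝ) : ℂ), ((1 - x) / 2 : ℝ)] := by
      ext i j
      fin_cases i <;> fin_cases j <;> simp [Vp, h, hx]
    refine ⟨!![(((x - 1) / 2 / x : ℝ) : ℂ), ((1 + x) / 2 / x : ℝ);
      ((1 / x : ℝ) : ℂ), ((-1 / x : ℝ) : ℂ)], ?_, ?_⟩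
    · rw [hV]
      ext i j
      fin_cases i <;> fin_cases j <;>
        simp [Matrix.mul_apply, Fin.sum_univ_two] <;> field_simp <;> ring
    · rw [hV, ← hx]
      unfold frobNorm
      simp only [Fin.sum_univ_two, Matrix.of_apply, Matrix.cons_val', Matrix.cons_val_zero,
        Matrix.cons_val_one, Matrix.cons_val_fin_one, Complex.norm_real, Real.norm_eq_abs, sq_abs]
      rw [← Real.sqrt_mul (by positivity)]
      apply Real.sqrt_le_iff.2
      refine ⟨by positivity, ?_⟩
      have : ((1:ℝ) ^ 2 + ((1 + x) / 2) ^ 2 + (1 ^ 2 + ((1 - x) / 2) ^ 2)) *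
        (((x - 1) / 2 / x) ^ 2 + ((1 + x) / 2 / x) ^ 2 + ((1 / x) ^ 2 + (-1 / x) ^ 2))
        = ((5 + x ^ 2) / (2 * x)) ^ 2 := by
        field_simp; ring
      rw [this]
      apply pow_le_pow_left₀ (by positivity)
      rw [div_le_iff₀ (by positivity)]
      nlinarith
  · have hV : (Vp p).map Complex.ofReal
        = !![((1 : ℝ) : ℂ), (x : ℝ); ((1 : ℝ) : ℂ), (-x : ℝ)] := by
      ext i j
      fin_cases i <;> fin_cases j <;> simp [Vp, h, hx]
    refine ⟨!![((1 / 2 : ℝ) : ℂ), (1 / 2 : ℝ);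
      ((1 / (2 * x) : ℝ) : ℂ), ((-1 / (2 * x) : ℝ) : ℂ)], ?_, ?_⟩
    · rw [hV]
      ext i j
      fin_cases i <;> fin_cases j <;>
        simp [Matrix.mul_apply, Fin.sum_univ_two] <;> field_simp <;> ring
    · rw [hV, ← hx]
      unfold frobNorm
      simp only [Fin.sum_univ_two, Matrix.of_apply, Matrix.cons_val', Matrix.cons_val_zero,
        Matrix.cons_val_one, Matrix.cons_val_fin_one, Complex.norm_real, Real.norm_eq_abs, sq_abs]
      rw [← Real.sqrt_mul (by positivity)]
      apply Real.sqrt_le_iff.2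
      refine ⟨by positivity, ?_⟩
      have : ((1:ℝ) ^ 2 + x ^ 2 + (1 ^ 2 + (-x) ^ 2)) *
        ((1 / 2) ^ 2 + (1 / 2) ^ 2 + ((1 / (2 * x)) ^ 2 + (-1 / (2 * x)) ^ 2))
        = ((1 + x ^ 2) / x) ^ 2 := by
        field_simp; ring
      rw [this]
      apply pow_le_pow_left₀ (by positivity)
      rw [div_le_iff₀ (by positivity)]
      nlinarith

lemma frobNorm_kronProd {r : ℕ} {t : Fin r → ℕ}
    (V : ∀ i, Matrix (Fin (t i)) (Fin (t i)) ℂ) :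
    frobNorm (kronProd V) = ∏ i, frobNorm (V i) := by
  unfold frobNorm kronProd
  rw [← Real.sqrt_prod]
  · congr 1
    simp only [Matrix.of_apply, norm_prod, ← Finset.prod_pow]
    rw [Finset.prod_univ_sum, Fintype.piFinset_univ]
    refine Finset.sum_congr rfl fun f _ => ?_
    rw [Finset.prod_univ_sum, Fintype.piFinset_univ]
  · intros; positivity

lemma kronProd_mul {r : ℕ} {t : Fin r → ℕ}
    (W V : ∀ i, Matrix (Fin (t i)) (Fin (t i)) ℂ) (h : ∀ i, W i * V i = 1) :
    kronProd W * kronProd V = 1 := by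
  ext f g
  simp only [Matrix.mul_apply, kronProd, Matrix.of_apply, ← Finset.prod_mul_distrib]
  have := Finset.prod_univ_sum (fun i => (Finset.univ : Finset (Fin (t i))))
    (fun i j => W i (f i) j * V i j (g i))
  rw [Fintype.piFinset_univ] at this
  rw [← this]
  simp only [← Matrix.mul_apply, h, Matrix.one_apply]
  by_cases hfg : f = g
  · subst hfg; simp
  · rw [if_neg hfg]
    obtain ⟨i, hi⟩ := Function.ne_iff.1 hfg
    exact Finset.prod_eq_zero (Finset.mem_univ i) (if_neg hi)

lemma frobNorm_kron {m n : Type*} [Fintype m] [Fintype n]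
    (A : Matrix m m ℂ) (B : Matrix n n ℂ) : frobNorm (A ⊗ₖ B) = frobNorm A * frobNorm B := by
  unfold frobNorm
  rw [← Real.sqrt_mul (by positivity)]
  congr 1
  simp only [Fintype.sum_prod_type, Matrix.kroneckerMap_apply, norm_mul, mul_pow]
  simp only [Finset.sum_mul_sum]

lemma frobNorm_nonneg' {m n : Type*} [Fintype m] [Fintype n]
    (A : Matrix m n ℂ) : 0 ≤ frobNorm A := Real.sqrt_nonneg _

lemma totient_prod_aux {s : ℕ} (f : Fin s → ℕ) (S : Finset (Fin s))
    (h : Pairwise fun i j => Nat.Coprime (f i) (f j)) :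
    (∏ j ∈ S, f j).totient = ∏ j ∈ S, (f j).totient := by
  classical
  induction S using Finset.induction_on with
  | empty => simp
  | insert a S ha ih =>
    rw [Finset.prod_insert ha, Finset.prod_insert ha, Nat.totient_mul, ih]
    exact Nat.Coprime.prod_right fun i hi => h (fun e => ha (e ▸ hi))

theorem condNum_TVK_le (s : ℕ) (q k : Fin s → ℕ)
    (hq : ∀ j, Nat.Prime (q j)) (hqinj : Function.Injective q)
    (hk : ∀ j, 1 ≤ k j) (n : ℕ) (hn2 : 2 ≤ n) (hn : n = ∏ j, q j ^ k j)
    (ζ : ∀ j, Fin (q j ^ k j).totient → ℂ)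
    (hζ : ∀ j a, IsPrimitiveRoot (ζ j a) (q j ^ k j))
    (hζinj : ∀ j, Function.Injective (ζ j))
    (r : ℕ) (p : Fin r → ℕ) (hp : ∀ i, Nat.Prime (p i))
    (hpinj : Function.Injective p) (hpn : ∀ i, ¬ p i ∣ n) :
    condNum ((kronProd fun j =>
          Matrix.of fun a b : Fin (q j ^ k j).totient => ζ j a ^ (b : ℕ)) ⊗ₖ
        kronProd fun i => (Vp (p i)).map Complex.ofReal) ≤
      (n.totient : ℝ) * (2 : ℝ) ^ ((n.primeFactors.card : ℝ) / 2) *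
        ∏ i, (2 + Real.sqrt (p i)) := by
  choose W hW1 hW2 using fun j => cyc_bound (q j) (k j) (hq j) (hk j) (ζ j) (hζ j) (hζinj j)
  choose U hU1 hU2 using fun i => Vp_bound (p i) (hp i)
  have hinv := Matrix.inv_eq_left_inv (A := (kronProd fun j =>
          Matrix.of fun a b : Fin (q j ^ k j).totient => ζ j a ^ (b : ℕ)) ⊗ₖ
        kronProd fun i => (Vp (p i)).map Complex.ofReal) (B := kronProd W ⊗ₖ kronProd U) (by
      rw [← Matrix.mul_kronecker_mul, kronProd_mul _ _ hW1, kronProd_mul _ _ hU1,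
        Matrix.one_kronecker_one])
  unfold condNum
  rw [hinv, frobNorm_kron, frobNorm_kron, frobNorm_kronProd, frobNorm_kronProd, frobNorm_kronProd,
    frobNorm_kronProd, mul_mul_mul_comm, ← Finset.prod_mul_distrib, ← Finset.prod_mul_distrib]
  have htot : (n.totient : ℝ) = ∏ j, ((q j ^ k j).totient : ℝ) := by
    rw [hn, totient_prod_aux, Nat.cast_prod]
    intro i j hij
    exact Nat.Coprime.pow _ _ ((Nat.coprime_primes (hq i) (hq j)).2 fun e => hij (hqinj e))
  have hcard : s ≤ n.primeFactors.card := by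
    have : Finset.univ.image q ⊆ n.primeFactors := by
      intro x hx
      obtain ⟨j, _, rfl⟩ := Finset.mem_image.1 hx
      refine Nat.mem_primeFactors.2 ⟨hq j, ?_, by omega⟩
      rw [hn]
      exact (dvd_pow_self _ (by have := hk j; omega)).trans
        (Finset.dvd_prod_of_mem (fun j => q j ^ k j) (Finset.mem_univ j))
    have h2 := Finset.card_le_card this
    rw [Finset.card_image_of_injective _ hqinj] at h2
    simpa using h2
  have hpow : ∏ _j : Fin s, Real.sqrt 2 ≤ (2 : ℝ) ^ ((n.primeFactors.card : ℝ) / 2) := by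
    rw [Finset.prod_const, Finset.card_univ, Fintype.card_fin, Real.sqrt_eq_rpow,
      ← Real.rpow_natCast, ← Real.rpow_mul (by norm_num)]
    apply Real.rpow_le_rpow_of_exponent_le (by norm_num)
    have : (s : ℝ) ≤ n.primeFactors.card := by exact_mod_cast hcard
    linarith
  apply mul_le_mul
  · calc _ ≤ ∏ j, (((q j ^ k j).totient : ℝ) * Real.sqrt 2) :=
          Finset.prod_le_prod (fun j _ => mul_nonneg (frobNorm_nonneg' _) (frobNorm_nonneg' _))
            (fun j _ => hW2 j)
      _ = n.totient * ∏ _j : Fin s, Real.sqrt 2 := by rw [Finset.prod_mul_distrib, htot]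
      _ ≤ _ := mul_le_mul_of_nonneg_left hpow (Nat.cast_nonneg _)
  · exact Finset.prod_le_prod (fun j _ => mul_nonneg (frobNorm_nonneg' _) (frobNorm_nonneg' _))
      (fun j _ => hU2 j)
  · exact Finset.prod_nonneg fun j _ => mul_nonneg (frobNorm_nonneg' _) (frobNorm_nonneg' _)
  · positivity
end

section
/- Let n ≥ 2 be an integer divisible by at most 3 distinct primes, let ε = ω(n) be the number of distinct primes dividing n, and set m = φ(n). Then Cond(V_{Φ_n}) ≤ 4 · φ(rad(n))^{ε−1} · m². -/
open Polynomial

def MB (P : PowerSeries ℤ) (L : ℤ) : Prop :=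
  ∀ S : PowerSeries ℤ, ∀ H : ℤ, (∀ j, |PowerSeries.coeff j S| ≤ H) →
    ∀ j, |PowerSeries.coeff j (P * S)| ≤ L * H

lemma MB.mul {P Q : PowerSeries ℤ} {a b : ℤ} (hP : MB P a) (hQ : MB Q b) : MB (P * Q) (a * b) := by
  intro S H hS j
  rw [mul_assoc, mul_assoc]
  exact hP _ _ (hQ S H hS) j

lemma MB_Xpow (k : ℕ) : MB (PowerSeries.X ^ k) 1 := by
  intro S H hS j
  rw [PowerSeries.coeff_X_pow_mul', one_mul]
  split_ifs
  · exact hS _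
  · simpa using (abs_nonneg _).trans (hS 0)

lemma MB_X_pow_sub_one (k : ℕ) : MB (PowerSeries.X ^ k - 1) 2 := by
  intro S H hS j
  have h1 := MB_Xpow k S H hS j
  have h2 := hS j
  rw [sub_mul, one_mul, map_sub]
  have := abs_sub (PowerSeries.coeff j (PowerSeries.X ^ k * S)) (PowerSeries.coeff j S)
  linarith

lemma MB_geom (q : ℕ) : MB (∑ i ∈ Finset.range q, PowerSeries.X ^ i) q := by
  intro S H hS j
  rw [Finset.sum_mul, map_sum]
  refine (Finset.abs_sum_le_sum_abs _ _).trans ?_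
  refine (Finset.sum_le_card_nsmul _ _ H ?_).trans (by simp)
  intro i _
  simpa using MB_Xpow i S H hS j

lemma series_exists (N p : ℕ) (hN : 2 ≤ N) (hc : Nat.Coprime N p) (hp : 0 < p) (H : ℤ)
    (hH : ∀ j, |(cyclotomic N ℤ).coeff j| ≤ H) :
    ∃ S : PowerSeries ℤ, (∀ j, |PowerSeries.coeff j S| ≤ H) ∧
      (1 - PowerSeries.X ^ N) * S = ((expand ℤ p (cyclotomic N ℤ) : ℤ[X]) : PowerSeries ℤ) := by
  have hH0 : 0 ≤ H := (abs_nonneg _).trans (hH 0)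
  set e := expand ℤ p (cyclotomic N ℤ) with he
  refine ⟨PowerSeries.mk fun j => ∑ s ∈ (Finset.range (j+1)).filter (fun s => s ≡ j [MOD N]), e.coeff s, ?_, ?_⟩
  · intro j
    rw [PowerSeries.coeff_mk]
    by_cases hex : ∃ s ∈ (Finset.range (j+1)).filter (fun s => s ≡ j [MOD N]), e.coeff s ≠ 0
    · obtain ⟨s, hs, hs0⟩ := hex
      rw [Finset.sum_eq_single_of_mem s hs]
      · rw [he, coeff_expand hp]
        split_ifs
        · exact hH _
        · simpa using hH0
      · intro t ht hts
        by_contra ht0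
        apply hts
        have key : ∀ s, e.coeff s ≠ 0 → ∃ i, s = p * i ∧ i < N := by
          intro s hs0
          rw [he, coeff_expand hp] at hs0
          split_ifs at hs0 with hd
          · refine ⟨s / p, (Nat.mul_div_cancel' hd).symm, ?_⟩
            have := le_natDegree_of_ne_zero hs0
            rw [natDegree_cyclotomic] at this
            exact this.trans_lt (Nat.totient_lt N (by omega))
          · exact absurd rfl hs0
        obtain ⟨i, rfl, hi⟩ := key s hs0
        obtain ⟨k, rfl, hk⟩ := key t ht0
        have h1 : p * k ≡ p * i [MOD N] :=
          ((Finset.mem_filter.1 ht).2).trans ((Finset.mem_filter.1 hs).2).symm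
        have h2 : k ≡ i [MOD N] := Nat.ModEq.cancel_left_of_coprime hc h1
        rw [Nat.ModEq.eq_of_lt_of_lt h2 hk hi]
    · push Not at hex
      rw [Finset.sum_eq_zero hex]
      simpa using hH0
  · ext j
    rw [sub_mul, one_mul, map_sub, PowerSeries.coeff_X_pow_mul', Polynomial.coeff_coe,
      PowerSeries.coeff_mk]
    rw [Finset.sum_filter, Finset.sum_range_succ, if_pos (Nat.ModEq.refl _)]
    have : (∑ x ∈ Finset.range j, if x ≡ j [MOD N] then e.coeff x else 0) =
        if N ≤ j then PowerSeries.coeff (j - N) (PowerSeries.mk fun j => ∑ s ∈ (Finset.range (j+1)).filter (fun s => s ≡ j [MOD N]), e.coeff s) else 0 := by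
      split_ifs with hj
      · rw [PowerSeries.coeff_mk, ← Finset.sum_filter]
        apply Finset.sum_congr _ (fun _ _ => rfl)
        ext s
        simp only [Finset.mem_filter, Finset.mem_range]
        have hmod : j - N ≡ j [MOD N] := by
          have : j - N + N = j := by omega
          conv_rhs => rw [← this]
          simp [Nat.ModEq]
        constructor
        · rintro ⟨h1, h2⟩
          refine ⟨?_, h2.trans hmod.symm⟩
          have := (Nat.modEq_iff_dvd' h1.le).1 h2
          have := Nat.le_of_dvd (by omega) this
          omega
        · rintro ⟨h1, h2⟩
          exact ⟨by omega, h2.trans hmod⟩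
      · apply Finset.sum_eq_zero
        intro s hs
        rw [if_neg]
        intro h
        have hs := Finset.mem_range.1 hs
        have := (Nat.modEq_iff_dvd' hs.le).1 h
        have := Nat.le_of_dvd (by omega) this
        omega
    rw [this]; ring

lemma height_step (N p : ℕ) (hN : 2 ≤ N) (hp : p.Prime) (hpN : ¬ p ∣ N) (H L : ℤ)
    (hH : ∀ j, |(cyclotomic N ℤ).coeff j| ≤ H) (Ψ : ℤ[X])
    (hΨ : cyclotomic N ℤ * Ψ = X ^ N - 1) (hL : MB (Ψ : PowerSeries ℤ) L) :
    ∀ j, |(cyclotomic (N * p) ℤ).coeff j| ≤ L * H := by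
  obtain ⟨S, hS, hS2⟩ := series_exists N p hN ((Nat.Prime.coprime_iff_not_dvd hp).2 hpN).symm hp.pos H hH
  have h1 := hL S H hS
  have h2 : (cyclotomic (N * p) ℤ : PowerSeries ℤ) = - ((Ψ : PowerSeries ℤ) * S) := by
    have hne : (1 - PowerSeries.X ^ N : PowerSeries ℤ) ≠ 0 := by
      intro h
      have := congrArg (PowerSeries.coeff 0) h
      rw [map_sub, PowerSeries.coeff_X_pow] at this
      rw [if_neg (by omega)] at this
      simp at this
    apply mul_left_cancel₀ hne
    have h3 : (X ^ N - 1) * cyclotomic (N * p) ℤ = expand ℤ p (cyclotomic N ℤ) * Ψ := by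
      rw [cyclotomic_expand_eq_cyclotomic_mul hp hpN, ← hΨ]; ring
    have h4 := congrArg (Polynomial.toPowerSeries) h3
    simp only [Polynomial.coe_mul, Polynomial.coe_sub, Polynomial.coe_pow, Polynomial.coe_X, Polynomial.coe_one] at h4
    rw [← hS2] at h4
    linear_combination -h4
  intro j
  have h5 := h1 j
  rw [← Polynomial.coeff_coe, h2, map_neg, abs_neg]
  exact h5

lemma expand_cyc : ∀ k : ℕ, k ≠ 0 → ∀ N : ℕ, (∀ p, p.Prime → p ∣ k → p ∣ N) →
    expand ℤ k (cyclotomic N ℤ) = cyclotomic (N * k) ℤ := by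
  intro k
  induction k using Nat.recOnMul with
  | zero => intro h; exact absurd rfl h
  | one => intro _ _ _; simp
  | prime p hp =>
    intro _ N h
    exact cyclotomic_expand_eq_cyclotomic hp (h p hp dvd_rfl) ℤ
  | mul a b ha hb =>
    intro h0 N h
    rw [expand_mul, hb (by rintro rfl; simp at h0) N (fun p hp hd => h p hp (hd.mul_left a)),
      ha (by rintro rfl; simp at h0) (N * b)
        (fun p hp hd => (h p hp (hd.mul_right b)).mul_right b)]
    congr 1; ring

/-- Height bound `H` for the cyclotomic polynomial and bound `B` for the cofactor on the circle. -/
def Good (n : ℕ) (H : ℤ) (B : ℝ) : Prop :=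
  (∀ j, |(cyclotomic n ℤ).coeff j| ≤ H) ∧
  ∃ Ψ : ℤ[X], cyclotomic n ℤ * Ψ = X ^ n - 1 ∧ ∀ y : ℂ, ‖y‖ = 1 → ‖aeval y Ψ‖ ≤ B

lemma Good.expand {N k : ℕ} {H : ℤ} {B : ℝ} (h : Good N H B) (hk : k ≠ 0)
    (hd : ∀ p, p.Prime → p ∣ k → p ∣ N) : Good (N * k) H B := by
  obtain ⟨h1, Ψ, h2, h3⟩ := h
  refine ⟨?_, Polynomial.expand ℤ k Ψ, ?_, ?_⟩
  · intro j
    rw [← expand_cyc k hk N hd, coeff_expand (Nat.pos_of_ne_zero hk)]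
    split_ifs
    · exact h1 _
    · simpa using (abs_nonneg _).trans (h1 0)
  · rw [← expand_cyc k hk N hd, ← map_mul, h2, map_sub, map_pow, expand_X, map_one, ← pow_mul,
      mul_comm k N]
  · intro y hy
    rw [expand_aeval]
    exact h3 _ (by simp [hy])

lemma cyc_circle {N : ℕ} (hN : 2 ≤ N) {H : ℤ} (hH : ∀ j, |(cyclotomic N ℤ).coeff j| ≤ H)
    (y : ℂ) (hy : ‖y‖ = 1) : ‖aeval y (cyclotomic N ℤ)‖ ≤ H * N := by
  have hdeg : (cyclotomic N ℤ).natDegree < N := by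
    rw [natDegree_cyclotomic]; exact Nat.totient_lt N (by omega)
  rw [aeval_eq_sum_range' hdeg]
  refine (norm_sum_le _ _).trans ?_
  refine (Finset.sum_le_card_nsmul _ _ (H : ℝ) ?_).trans (by simp [mul_comm])
  intro i _
  rw [zsmul_eq_mul, norm_mul, norm_pow, hy, one_pow, mul_one, Complex.norm_intCast]
  exact_mod_cast hH i

lemma X_pow_circle (k : ℕ) (y : ℂ) (hy : ‖y‖ = 1) : ‖aeval y (X ^ k - 1 : ℤ[X])‖ ≤ 2 := by
  simp only [map_sub, map_pow, aeval_X, map_one]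
  refine (norm_sub_le _ _).trans ?_
  simp [hy]; norm_num

lemma height_prime {p : ℕ} (hp : p.Prime) : ∀ j, |(cyclotomic p ℤ).coeff j| ≤ 1 := by
  intro j
  have := Fact.mk hp
  rw [cyclotomic_prime, finsetSum_coeff]
  simp only [coeff_X_pow]
  rw [Finset.sum_ite_eq]
  split_ifs <;> simp

lemma MB_prime {p : ℕ} (hp : p.Prime) : MB (cyclotomic p ℤ : PowerSeries ℤ) p := by
  have := Fact.mk hp
  have := MB_geom p
  convert this
  rw [cyclotomic_prime, ← Polynomial.coeToPowerSeries.ringHom_apply, map_sum]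
  simp

lemma good_one {p : ℕ} (hp : p.Prime) : Good p 1 2 := by
  have := Fact.mk hp
  refine ⟨height_prime hp, X - 1, cyclotomic_prime_mul_X_sub_one ℤ p, ?_⟩
  intro y hy
  simpa using X_pow_circle 1 y hy

lemma psi_two {p q : ℕ} (hp : p.Prime) (hq : q.Prime) (h : q ≠ p) :
    cyclotomic (q * p) ℤ * ((X ^ p - 1) * cyclotomic q ℤ) = X ^ (q * p) - 1 := by
  have := Fact.mk hq
  have hd : ¬ p ∣ q := fun hd => h ((Nat.prime_dvd_prime_iff_eq hp hq).1 hd).symm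
  have h1 := cyclotomic_expand_eq_cyclotomic_mul hp hd ℤ
  have h2 := congrArg (Polynomial.expand ℤ p) (cyclotomic_prime_mul_X_sub_one ℤ q)
  rw [map_mul, h1] at h2
  simp only [map_sub, map_pow, expand_X, map_one] at h2
  rw [← pow_mul, mul_comm p q] at h2
  rw [← h2]; ring

lemma psi_two_circle {q : ℕ} (p : ℕ) (hq : q.Prime) (y : ℂ) (hy : ‖y‖ = 1) :
    ‖aeval y ((X ^ p - 1) * cyclotomic q ℤ)‖ ≤ 2 * q := by
  rw [map_mul, norm_mul]
  have h1 := X_pow_circle p y hy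
  have h2 := cyc_circle hq.two_le (height_prime hq) y hy
  rw [Int.cast_one, one_mul] at h2
  gcongr

lemma good_two {p q : ℕ} (hp : p.Prime) (hq : q.Prime) (h : q ≠ p) :
    Good (q * p) 2 (2 * q) := by
  have := Fact.mk hq
  have hd : ¬ p ∣ q := fun hd => h ((Nat.prime_dvd_prime_iff_eq hp hq).1 hd).symm
  refine ⟨?_, (X ^ p - 1) * cyclotomic q ℤ, psi_two hp hq h, psi_two_circle p hq⟩
  have := height_step q p hq.two_le hp hd 1 2 (height_prime hq) (X - 1)
    (cyclotomic_prime_mul_X_sub_one ℤ q) (by simpa using MB_X_pow_sub_one 1)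
  simpa using this

lemma good_three {p q r : ℕ} (hp : p.Prime) (hq : q.Prime) (hr : r.Prime) (h : q ≠ p)
    (h1 : q ≠ r) (h2 : p ≠ r) : Good (q * p * r) (2 * q * 2) (2 * (q * p) * (2 * q)) := by
  have hd : ¬ r ∣ q * p := by
    rw [hr.dvd_mul, Nat.prime_dvd_prime_iff_eq hr hq, Nat.prime_dvd_prime_iff_eq hr hp]
    tauto
  have hg := good_two hp hq h
  have hN : 2 ≤ q * p := by nlinarith [hp.two_le, hq.two_le]
  refine ⟨?_, cyclotomic (q * p) ℤ * Polynomial.expand ℤ r ((X ^ p - 1) * cyclotomic q ℤ), ?_, ?_⟩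
  · refine height_step (q * p) r hN hr hd 2 (2 * q) hg.1 _ (psi_two hp hq h) ?_
    rw [Polynomial.coe_mul]
    refine MB.mul ?_ (MB_prime hq)
    simpa using MB_X_pow_sub_one p
  · have h3 := congrArg (Polynomial.expand ℤ r) (psi_two hp hq h)
    rw [map_mul, cyclotomic_expand_eq_cyclotomic_mul hr hd] at h3
    rw [← mul_assoc, h3]
    simp only [map_sub, map_pow, expand_X, map_one]
    rw [← pow_mul, mul_comm r]
  · intro y hy
    rw [map_mul, norm_mul, expand_aeval]
    have h3 := cyc_circle hN hg.1 y hy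
    have h4 := psi_two_circle p hq (y ^ r) (by simp [hy])
    push_cast at h3
    gcongr

lemma cond_bound (n : ℕ) (hn : 2 ≤ n) (ζ : Fin n.totient → ℂ)
    (hζ : ∀ i, IsPrimitiveRoot (ζ i) n) (hinj : Function.Injective ζ)
    (H : ℤ) (B : ℝ) (hg : Good n H B) :
    condNum (Matrix.of fun i j : Fin n.totient => ζ i ^ (j : ℕ)) ≤
      (H * n.totient * B / n) * (n.totient : ℝ) ^ 2 := by
  obtain ⟨hH, Ψ, hΨ, hB⟩ := hg
  have hnorm : ∀ i, ‖ζ i‖ = 1 := fun i => (hζ i).norm'_eq_one (by omega)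
  have hroot : ∀ i, (cyclotomic n ℂ).IsRoot (ζ i) := fun i => (hζ i).isRoot_cyclotomic (by omega)
  have hex : ∀ i, ∃ Q : ℂ[X], cyclotomic n ℂ = (X - C (ζ i)) * Q := fun i =>
    dvd_iff_isRoot.2 (hroot i)
  choose Q hQ using hex
  have hHR : ∀ j, ‖(cyclotomic n ℂ).coeff j‖ ≤ (H : ℝ) := by
    intro j
    rw [← map_cyclotomic_int, coeff_map, eq_intCast, Complex.norm_intCast]
    exact_mod_cast hH j
  have hH0 : (0 : ℝ) ≤ H := (norm_nonneg _).trans (hHR 0)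
  have hn0 : (0 : ℝ) < n := by positivity
  -- coefficients of the quotients
  have hcoef : ∀ i j, ‖(Q i).coeff j‖ ≤ H * (j + 1) := by
    intro i j
    induction j with
    | zero =>
      have h := hHR 0
      rw [hQ i, mul_coeff_zero] at h
      simpa [hnorm i] using h
    | succ j ih =>
      have h := hHR (j + 1)
      rw [hQ i, sub_mul, coeff_sub, coeff_X_mul, coeff_C_mul] at h
      have h2 := norm_sub_norm_le (ζ i * (Q i).coeff (j + 1)) ((Q i).coeff j)
      rw [norm_mul, hnorm i, one_mul, norm_sub_rev] at h2
      push_cast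
      linarith
  have hdeg : ∀ i, (Q i).natDegree < n.totient := by
    intro i
    have h := congrArg natDegree (hQ i)
    have hne : Q i ≠ 0 := by
      intro h0
      have := hQ i
      rw [h0, mul_zero] at this
      exact cyclotomic_ne_zero n ℂ this
    rw [natDegree_cyclotomic, natDegree_mul (X_sub_C_ne_zero _) hne, natDegree_X_sub_C] at h
    omega
  -- value at the own node
  have hval : ∀ i, (n : ℝ) = ‖(Q i).eval (ζ i)‖ * ‖aeval (ζ i) Ψ‖ := by
    intro i
    have h := congrArg (Polynomial.map (Int.castRingHom ℂ)) hΨ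
    rw [Polynomial.map_mul, map_cyclotomic_int, hQ i] at h
    simp only [Polynomial.map_sub, Polynomial.map_pow, map_X, Polynomial.map_one] at h
    have h2 := congrArg (fun P => (derivative P).eval (ζ i)) h
    simp [derivative_mul, derivative_X_pow] at h2
    have h3 := congrArg norm h2
    rw [norm_mul, norm_mul, norm_pow, hnorm i, one_pow, mul_one, Complex.norm_natCast] at h3
    rw [← h3, aeval_def, eval_map]
    rfl
  have hval0 : ∀ i, (Q i).eval (ζ i) ≠ 0 := by
    intro i h
    have := hval i
    rw [h, norm_zero, zero_mul] at this
    linarith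
  have hinvval : ∀ i, ‖(Q i).eval (ζ i)‖⁻¹ ≤ B / n := by
    intro i
    have h1 : 0 < ‖(Q i).eval (ζ i)‖ := norm_pos_iff.2 (hval0 i)
    rw [inv_eq_one_div, div_le_div_iff₀ h1 hn0, one_mul, hval i, mul_comm]
    exact mul_le_mul_of_nonneg_right (hB _ (hnorm i)) h1.le
  have hinv : (Matrix.of fun i j : Fin n.totient => ζ i ^ (j : ℕ))⁻¹ =
      Matrix.of fun j i : Fin n.totient => (Q i).coeff j * ((Q i).eval (ζ i))⁻¹ := by
    apply Matrix.inv_eq_right_inv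
    ext a b
    rw [Matrix.mul_apply]
    simp only [Matrix.of_apply]
    have h1 : ∑ j : Fin n.totient, ζ a ^ (j : ℕ) * ((Q b).coeff j * ((Q b).eval (ζ b))⁻¹) =
        (Q b).eval (ζ a) * ((Q b).eval (ζ b))⁻¹ := by
      rw [eval_eq_sum_range' (hdeg b) (ζ a), Finset.sum_mul, ← Fin.sum_univ_eq_sum_range
        (fun j => (Q b).coeff j * ζ a ^ j * ((Q b).eval (ζ b))⁻¹)]
      exact Finset.sum_congr rfl fun _ _ => by ring
    rw [h1]
    by_cases hab : a = b
    · subst hab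
      rw [Matrix.one_apply_eq, mul_inv_cancel₀ (hval0 a)]
    · rw [Matrix.one_apply_ne hab]
      have h2 : (cyclotomic n ℂ).eval (ζ a) = 0 := hroot a
      rw [hQ b, eval_mul, eval_sub, eval_X, eval_C] at h2
      have h3 : ζ a - ζ b ≠ 0 := sub_ne_zero.2 fun h => hab (hinj h)
      rw [(mul_eq_zero.1 h2).resolve_left h3, zero_mul]
  have hC0 : 0 ≤ H * n.totient * B / n := by
    have : 0 ≤ B := (norm_nonneg _).trans (hB 1 (by simp))
    positivity
  have hfrob : ∀ (A : Matrix (Fin n.totient) (Fin n.totient) ℂ) (c : ℝ), 0 ≤ c →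
      (∀ i j, ‖A i j‖ ≤ c) → frobNorm A ≤ c * n.totient := by
    intro A c hc hA
    unfold frobNorm
    apply Real.sqrt_le_iff.2 ⟨by positivity, ?_⟩
    calc ∑ i, ∑ j, ‖A i j‖ ^ 2 ≤ ∑ i : Fin n.totient, ∑ j : Fin n.totient, c ^ 2 := by
          gcongr; exact hA _ _
      _ = (c * n.totient) ^ 2 := by simp; ring
  unfold condNum
  have f1 := hfrob (Matrix.of fun i j : Fin n.totient => ζ i ^ (j : ℕ)) 1 zero_le_one
    (by intro i j; simp [hnorm i])
  have f2 := hfrob (Matrix.of fun i j : Fin n.totient => ζ i ^ (j : ℕ))⁻¹ _ hC0 (by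
    intro j i
    rw [hinv, Matrix.of_apply, norm_mul, norm_inv]
    have h1 := hcoef i j
    have h2 : (H : ℝ) * (j + 1) ≤ H * n.totient := by
      apply mul_le_mul_of_nonneg_left _ hH0
      exact_mod_cast j.2
    calc _ ≤ (H * n.totient) * (B / n) :=
          mul_le_mul (h1.trans h2) (hinvval i) (by positivity) (by positivity)
      _ = _ := by ring)
  calc _ ≤ (1 * (n.totient : ℝ)) * (H * n.totient * B / n * n.totient) :=
        mul_le_mul f1 f2 (Real.sqrt_nonneg _) (by positivity)
    _ = _ := by ring

lemma rad_bound (n : ℕ) (hn : 2 ≤ n) (ζ : Fin n.totient → ℂ)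
    (hζ : ∀ i, IsPrimitiveRoot (ζ i) n) (hinj : Function.Injective ζ)
    (N : ℕ) (hN : ∏ p ∈ n.primeFactors, p = N) (e : ℕ)
    (H : ℤ) (B : ℝ) (hg : Good N H B)
    (hle : H * B * N.totient ≤ 4 * (N : ℝ) * (N.totient : ℝ) ^ e) :
    condNum (Matrix.of fun i j : Fin n.totient => ζ i ^ (j : ℕ)) ≤
      4 * (N.totient : ℝ) ^ e * (n.totient : ℝ) ^ 2 := by
  obtain ⟨k, hk⟩ : N ∣ n := hN ▸ Nat.prod_primeFactors_dvd n
  have hk0 : k ≠ 0 := by rintro rfl; simp at hk; omega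
  have hN0 : N ≠ 0 := by rintro rfl; simp at hk; omega
  have hd : ∀ p, p.Prime → p ∣ k → p ∣ N := by
    intro p hp hpk
    rw [← hN]
    exact Finset.dvd_prod_of_mem _ (Nat.mem_primeFactors.2 ⟨hp, hk ▸ hpk.mul_left N, by omega⟩)
  have htot : n.totient = N.totient * k := by
    have := congrArg natDegree (expand_cyc k hk0 N hd)
    rw [natDegree_expand, natDegree_cyclotomic, natDegree_cyclotomic, ← hk] at this
    exact this.symm
  have hgn : Good n H B := hk ▸ hg.expand hk0 hd
  refine (cond_bound n hn ζ hζ hinj H B hgn).trans ?_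
  apply mul_le_mul_of_nonneg_right _ (by positivity)
  have hNp : (0 : ℝ) < N := by positivity
  have hkp : (0 : ℝ) < k := by positivity
  rw [htot, div_le_iff₀ (by positivity), hk]
  push_cast
  calc _ = (H * B * N.totient) * k := by ring
    _ ≤ (4 * (N : ℝ) * (N.totient : ℝ) ^ e) * k := by gcongr
    _ = _ := by ring

lemma sorted_three (s : Finset ℕ) (h : s.card = 3) :
    ∃ a b c, a < b ∧ b < c ∧ s = {a, b, c} := by
  obtain ⟨x, y, z, hxy, hxz, hyz, rfl⟩ := Finset.card_eq_three.1 h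
  rcases lt_or_gt_of_ne hxy with h1 | h1 <;> rcases lt_or_gt_of_ne hxz with h2 | h2 <;>
    rcases lt_or_gt_of_ne hyz with h3 | h3
  · exact ⟨x, y, z, h1, h3, rfl⟩
  · exact ⟨x, z, y, h2, h3, by grind⟩
  · omega
  · exact ⟨z, x, y, h2, h1, by grind⟩
  · exact ⟨y, x, z, h1, h2, by grind⟩
  · omega
  · exact ⟨y, z, x, h3, h2, by grind⟩
  · exact ⟨z, y, x, h3, h1, by grind⟩

theorem condNum_vandermonde_three_primes (n : ℕ) (hn : 2 ≤ n)
    (hω : n.primeFactors.card ≤ 3)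
    (ζ : Fin n.totient → ℂ) (hζ : ∀ i, IsPrimitiveRoot (ζ i) n)
    (hinj : Function.Injective ζ) :
    condNum (Matrix.of fun i j : Fin n.totient => ζ i ^ (j : ℕ)) ≤
      4 * ((∏ p ∈ n.primeFactors, p).totient : ℝ) ^ (n.primeFactors.card - 1) *
        (n.totient : ℝ) ^ 2 := by
  have hpr : ∀ p ∈ n.primeFactors, p.Prime := fun p hp => Nat.prime_of_mem_primeFactors hp
  have hpos : 0 < n.primeFactors.card := Finset.card_pos.2 (Nat.nonempty_primeFactors.2 (by omega))
  obtain hc | hc | hc : n.primeFactors.card = 1 ∨ n.primeFactors.card = 2 ∨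
      n.primeFactors.card = 3 := by omega
  · obtain ⟨p, hs⟩ := Finset.card_eq_one.1 hc
    have hp : p.Prime := hpr p (by simp [hs])
    refine rad_bound n hn ζ hζ hinj _ rfl _ 1 2 ?_ ?_
    · rw [hs, Finset.prod_singleton]; exact good_one hp
    · rw [hc, hs, Finset.prod_singleton]
      have : (p.totient : ℝ) ≤ p := by exact_mod_cast Nat.totient_le p
      norm_num
      linarith
  · obtain ⟨q, p, hqp, hs⟩ := Finset.card_eq_two.1 hc
    have hp : p.Prime := hpr p (by simp [hs])
    have hq : q.Prime := hpr q (by simp [hs])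
    have hprod : ∏ p ∈ n.primeFactors, p = q * p := by rw [hs, Finset.prod_pair hqp]
    refine rad_bound n hn ζ hζ hinj _ rfl _ 2 (2 * q) ?_ ?_
    · rw [hprod]; exact good_two hp hq hqp
    · rw [hc, hprod]
      have h1 : (1 : ℝ) ≤ p := by exact_mod_cast hp.one_le
      have h2 : (0 : ℝ) ≤ q * (q * p).totient := by positivity
      push_cast
      norm_num
      nlinarith
  · obtain ⟨q, p, r, hqp, hpr', hs⟩ := sorted_three _ hc
    have hp : p.Prime := hpr p (by simp [hs])
    have hq : q.Prime := hpr q (by simp [hs])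
    have hr : r.Prime := hpr r (by simp [hs])
    have hprod : ∏ p ∈ n.primeFactors, p = q * p * r := by
      rw [hs, Finset.prod_insert (by simp; omega), Finset.prod_pair (by omega), mul_assoc]
    refine rad_bound n hn ζ hζ hinj _ rfl _ (2 * q * 2) (2 * (q * p) * (2 * q)) ?_ ?_
    · rw [hprod]; exact good_three hp hq hr (by omega) (by omega) (by omega)
    · rw [hc, hprod]
      have htot : (q * p * r).totient = (q - 1) * (p - 1) * (r - 1) := by
        have c1 : Nat.Coprime q p := (Nat.coprime_primes hq hp).2 (by omega)
        have c2 : Nat.Coprime q r := (Nat.coprime_primes hq hr).2 (by omega)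
        have c3 : Nat.Coprime p r := (Nat.coprime_primes hp hr).2 (by omega)
        rw [Nat.totient_mul (Nat.Coprime.mul_left c2 c3), Nat.totient_mul c1,
          Nat.totient_prime hp, Nat.totient_prime hq, Nat.totient_prime hr]
      have hkey : 4 * q ^ 2 ≤ r * (q * p * r).totient := by
        have a1 : 1 ≤ q - 1 := by have := hq.two_le; omega
        have a2 : q ≤ p - 1 := by omega
        have a3 : q + 1 ≤ r - 1 := by omega
        have a4 : q ≤ r - 2 := by omega
        have h2 := hq.two_le
        have h3 : q * (q + 1) ≤ (q * p * r).totient := by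
          rw [htot]
          calc q * (q + 1) = 1 * q * (q + 1) := by ring
            _ ≤ _ := by gcongr
        calc 4 * q ^ 2 ≤ 4 * (q * (q + 1)) := by nlinarith
          _ ≤ r * (q * p * r).totient := Nat.mul_le_mul (by omega) h3
      have hkey' : (4 : ℝ) * q ^ 2 ≤ r * (q * p * r).totient := by exact_mod_cast hkey
      have h2 : (0 : ℝ) ≤ 4 * q * p * (q * p * r).totient := by positivity
      have := mul_le_mul_of_nonneg_right hkey' h2
      push_cast
      norm_num
      nlinarith
end

section
/- Let n = p^a q^b r^c s^d with p < q < r < s distinct primes and a, b, c, d ≥ 1, and set m = φ(n). Then Cond(V_{Φ_n}) ≤ 4 · φ(rad(n))⁴ · m². -/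
open Polynomial

namespace CycCond

/-- The sum of the absolute values of the coefficients. -/
noncomputable def l1 (f : ℤ[X]) : ℤ := ∑ i ∈ f.support, |f.coeff i|

lemma l1_eq (f : ℤ[X]) (S : Finset ℕ) (h : f.support ⊆ S) :
    l1 f = ∑ i ∈ S, |f.coeff i| := by
  unfold l1
  apply Finset.sum_subset h
  intro i _ hi
  simp [notMem_support_iff.mp hi]

lemma l1_nonneg (f : ℤ[X]) : 0 ≤ l1 f := Finset.sum_nonneg fun _ _ => abs_nonneg _

lemma l1_add (f g : ℤ[X]) : l1 (f + g) ≤ l1 f + l1 g := by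
  classical
  rw [l1_eq (f + g) (f.support ∪ g.support) support_add,
    l1_eq f (f.support ∪ g.support) Finset.subset_union_left,
    l1_eq g (f.support ∪ g.support) Finset.subset_union_right, ← Finset.sum_add_distrib]
  apply Finset.sum_le_sum
  intro i _
  rw [coeff_add]
  exact abs_add_le _ _

lemma l1_zero : l1 0 = 0 := by simp [l1]

lemma l1_sum {ι : Type*} (S : Finset ι) (f : ι → ℤ[X]) :
    l1 (∑ i ∈ S, f i) ≤ ∑ i ∈ S, l1 (f i) := by
  classical
  induction S using Finset.induction_on with
  | empty => simp [l1_zero]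
  | insert a S ha ih =>
    rw [Finset.sum_insert ha, Finset.sum_insert ha]
    exact (l1_add _ _).trans (by linarith)

lemma l1_monomial (k : ℕ) (a : ℤ) : l1 (monomial k a) = |a| := by
  rw [l1_eq _ {k} (support_monomial_subset k a)]
  simp

lemma l1_mul (f g : ℤ[X]) : l1 (f * g) ≤ l1 f * l1 g := by
  have h : f * g = ∑ i ∈ f.support, ∑ j ∈ g.support,
      monomial (i + j) (f.coeff i * g.coeff j) := by
    conv_lhs => rw [f.as_sum_support, g.as_sum_support]
    rw [Finset.sum_mul_sum]
    simp [monomial_mul_monomial]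
  rw [h]
  refine (l1_sum _ _).trans ?_
  refine (Finset.sum_le_sum fun i _ => l1_sum _ _).trans ?_
  simp only [l1_monomial, abs_mul]
  unfold l1
  rw [Finset.sum_mul_sum]

lemma l1_expand (l : ℕ) (f : ℤ[X]) : l1 (expand ℤ l f) ≤ l1 f := by
  have h : expand ℤ l f = ∑ i ∈ f.support, monomial (i * l) (f.coeff i) := by
    conv_lhs => rw [f.as_sum_support]
    simp [expand_monomial]
  rw [h]
  refine (l1_sum _ _).trans ?_
  simp only [l1_monomial]
  rfl

lemma l1_le (f : ℤ[X]) (h : ℤ) (hf : ∀ i, |f.coeff i| ≤ h) :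
    l1 f ≤ (f.natDegree + 1) * h := by
  rw [l1_eq f (Finset.range (f.natDegree + 1)) supp_subset_range_natDegree_succ]
  refine (Finset.sum_le_card_nsmul _ _ h fun i _ => hf i).trans ?_
  simp

lemma coeff_mul_le (f g : ℤ[X]) (h : ℤ) (hg : ∀ i, |g.coeff i| ≤ h) (e : ℕ) :
    |(f * g).coeff e| ≤ l1 f * h := by
  have h0 : 0 ≤ h := (abs_nonneg _).trans (hg 0)
  conv_lhs => rw [f.as_sum_support, Finset.sum_mul, finsetSum_coeff]
  refine (Finset.abs_sum_le_sum_abs _ _).trans ?_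
  unfold l1
  rw [Finset.sum_mul]
  apply Finset.sum_le_sum
  intro i _
  rw [← C_mul_X_pow_eq_monomial, mul_assoc, coeff_C_mul, coeff_X_pow_mul', abs_mul]
  apply mul_le_mul_of_nonneg_left _ (abs_nonneg _)
  split_ifs
  · exact hg _
  · simpa using h0

/-- Division step. -/
lemma coeff_div (F G K : ℤ[X]) (m : ℕ) (hm : 0 < m) (h : ℤ) (h0 : 0 ≤ h)
    (hFG : F * (X ^ m - 1) = K * G) (hG : ∀ i, |G.coeff i| ≤ h)
    (huniq : ∀ i j, G.coeff i ≠ 0 → G.coeff j ≠ 0 → i ≡ j [MOD m] → i = j) (e : ℕ) :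
    |F.coeff e| ≤ l1 K * h := by
  set N := e + 1
  set B : ℤ[X] := ∑ t ∈ Finset.range N, G * X ^ (m * t) with hB
  have hgeo : (X ^ m - 1 : ℤ[X]) * ∑ t ∈ Finset.range N, X ^ (m * t) = X ^ (m * N) - 1 := by
    have := mul_geom_sum (X ^ m : ℤ[X]) N
    simpa [pow_mul] using this
  have hKB : F * (X ^ (m * N) - 1) = K * B := by
    rw [← hgeo, ← mul_assoc, hFG, hB, ← Finset.mul_sum, mul_assoc]
  have heN : e < m * N := by
    have : e + 1 ≤ m * (e + 1) := Nat.le_mul_of_pos_left _ hm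
    exact this
  have hFe : (K * B).coeff e = - F.coeff e := by
    rw [← hKB, mul_sub, coeff_sub, mul_one, coeff_mul_X_pow', if_neg (by omega)]
    simp
  rw [← abs_neg, ← hFe]
  apply coeff_mul_le
  intro i
  rw [hB, finsetSum_coeff]
  by_cases hex : ∃ t ∈ Finset.range N, (G * X ^ (m * t)).coeff i ≠ 0
  · obtain ⟨t, ht, hne⟩ := hex
    rw [Finset.sum_eq_single_of_mem t ht]
    · rw [coeff_mul_X_pow']
      split_ifs
      · exact hG _
      · simpa using h0
    · intro t' _ htt
      by_contra hne'
      have h1 : m * t ≤ i := by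
        by_contra hc
        exact hne (by rw [coeff_mul_X_pow', if_neg hc])
      have h2 : m * t' ≤ i := by
        by_contra hc
        exact hne' (by rw [coeff_mul_X_pow', if_neg hc])
      rw [coeff_mul_X_pow', if_pos h1] at hne
      rw [coeff_mul_X_pow', if_pos h2] at hne'
      have e1 : i - m * t ≡ i [MOD m] := by
        rw [Nat.modEq_iff_dvd' (by omega)]
        exact ⟨t, by omega⟩
      have e2 : i - m * t' ≡ i [MOD m] := by
        rw [Nat.modEq_iff_dvd' (by omega)]
        exact ⟨t', by omega⟩
      have key : i - m * t = i - m * t' := huniq _ _ hne hne' (e1.trans e2.symm)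
      have : m * t' = m * t := by omega
      exact htt (Nat.eq_of_mul_eq_mul_left hm this)
  · push Not at hex
    rw [Finset.sum_eq_zero hex]
    simpa using h0

/-- Height bound and inverse cyclotomic length bound. -/
def Good (m : ℕ) (h L : ℤ) : Prop :=
  (∀ i, |(cyclotomic m ℤ).coeff i| ≤ h) ∧
    ∃ P : ℤ[X], cyclotomic m ℤ * P = X ^ m - 1 ∧ l1 P ≤ L

lemma good_prime (p : ℕ) (hp : p.Prime) : Good p 1 2 := by
  have := Fact.mk hp
  refine ⟨fun i => ?_, X - 1, cyclotomic_prime_mul_X_sub_one ℤ p, ?_⟩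
  · rw [cyclotomic_prime, finsetSum_coeff]
    simp only [coeff_X_pow, Finset.sum_ite_eq]
    split_ifs <;> simp
  · have : (X - 1 : ℤ[X]) = monomial 1 1 + monomial 0 (-1) := by
      simp [monomial_zero_left, X, sub_eq_add_neg]
    rw [this]
    refine (l1_add _ _).trans ?_
    rw [l1_monomial, l1_monomial]
    norm_num

lemma good_step (m l : ℕ) (h L : ℤ) (hm : 1 < m) (hl : l.Prime) (hml : ¬ l ∣ m)
    (H : Good m h L) : Good (m * l) (L * h) ((m.totient + 1) * h * L) := by
  obtain ⟨h1, P, hP, hPL⟩ := H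
  have h0 : 0 ≤ h := (abs_nonneg _).trans (h1 0)
  have hexp := cyclotomic_expand_eq_cyclotomic_mul hl hml ℤ
  have hdeg : (cyclotomic m ℤ).natDegree = m.totient := natDegree_cyclotomic m ℤ
  have hcop : Nat.Coprime m l := ((Nat.Prime.coprime_iff_not_dvd hl).2 hml).symm
  have hne : cyclotomic m ℤ ≠ 0 := cyclotomic_ne_zero m ℤ
  refine ⟨fun e => ?_, cyclotomic m ℤ * expand ℤ l P, ?_, ?_⟩
  · refine (coeff_div (cyclotomic (m * l) ℤ) (expand ℤ l (cyclotomic m ℤ)) P m (by omega) h h0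
      ?_ ?_ ?_ e).trans ?_
    · rw [hexp, ← hP]; ring
    · intro i
      rw [coeff_expand hl.pos]
      split_ifs
      · exact h1 _
      · simpa using h0
    · intro i j hi hj hij
      rw [coeff_expand hl.pos] at hi hj
      split_ifs at hi hj with hi' hj'
      · obtain ⟨k, rfl⟩ := hi'
        obtain ⟨k', rfl⟩ := hj'
        rw [Nat.mul_div_cancel_left _ hl.pos] at hi hj
        have b1 := le_natDegree_of_ne_zero hi
        have b2 := le_natDegree_of_ne_zero hj
        have b3 := Nat.totient_lt m hm
        have : k ≡ k' [MOD m] := Nat.ModEq.cancel_left_of_coprime hcop hij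
        rw [Nat.ModEq, Nat.mod_eq_of_lt (by omega), Nat.mod_eq_of_lt (by omega)] at this
        rw [this]
      all_goals simp_all
    · exact mul_le_mul_of_nonneg_right hPL h0
  · have : expand ℤ l (cyclotomic m ℤ) * expand ℤ l P = X ^ (m * l) - 1 := by
      rw [← map_mul, hP]
      simp [mul_comm m l, pow_mul]
    rw [← this, hexp]; ring
  · refine (l1_mul _ _).trans ?_
    have := l1_le _ h h1
    rw [hdeg] at this
    exact mul_le_mul this ((l1_expand _ _).trans hPL) (l1_nonneg _) (by positivity)

/-- Length bounds for the cyclotomic and inverse cyclotomic polynomials. -/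
def Good2 (m : ℕ) (M L : ℤ) : Prop :=
  l1 (cyclotomic m ℤ) ≤ M ∧
    ∃ P : ℤ[X], cyclotomic m ℤ * P = X ^ m - 1 ∧ l1 P ≤ L

lemma Good.good2 {m : ℕ} {h L : ℤ} (H : Good m h L) : Good2 m ((m.totient + 1) * h) L := by
  refine ⟨?_, H.2⟩
  have := l1_le _ h H.1
  rwa [natDegree_cyclotomic m ℤ] at this

lemma good2_step (m l : ℕ) (M L : ℤ) (hl : l.Prime) (hml : l ∣ m)
    (H : Good2 m M L) : Good2 (m * l) M L := by
  obtain ⟨h1, P, hP, hPL⟩ := H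
  have hexp := cyclotomic_expand_eq_cyclotomic hl hml ℤ
  refine ⟨?_, expand ℤ l P, ?_, (l1_expand _ _).trans hPL⟩
  · rw [← hexp]; exact (l1_expand _ _).trans h1
  · rw [← hexp, ← map_mul, hP]
    simp [mul_comm m l, pow_mul]

lemma good2_pow (m l : ℕ) (M L : ℤ) (hl : l.Prime) (hml : l ∣ m)
    (H : Good2 m M L) (k : ℕ) : Good2 (m * l ^ k) M L := by
  induction k with
  | zero => simpa using H
  | succ k ih =>
    rw [pow_succ, ← mul_assoc]
    exact good2_step _ _ _ _ hl (hml.mul_right _) ih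

lemma norm_eval_le (f : ℤ[X]) (z : ℂ) (hz : ‖z‖ = 1) :
    ‖(f.map (Int.castRingHom ℂ)).eval z‖ ≤ (l1 f : ℝ) := by
  rw [eval_map, eval₂_eq_sum, sum_def]
  refine (norm_sum_le _ _).trans ?_
  unfold l1
  push_cast
  apply Finset.sum_le_sum
  intro i _
  simp [hz]

lemma norm_coeff_div_le (f : ℤ[X]) (z : ℂ) (hz : ‖z‖ = 1) (j : ℕ) :
    ‖((f.map (Int.castRingHom ℂ)) /ₘ (X - C z)).coeff j‖ ≤ (l1 f : ℝ) := by
  rw [coeff_divByMonic_X_sub_C]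
  refine (norm_sum_le _ _).trans ?_
  rw [l1_eq f (f.support ∪ Finset.Icc (j + 1) (f.map (Int.castRingHom ℂ)).natDegree)
    Finset.subset_union_left]
  push_cast
  refine le_trans (le_of_eq ?_) (Finset.sum_le_sum_of_subset_of_nonneg
    Finset.subset_union_right fun _ _ _ => abs_nonneg _)
  apply Finset.sum_congr rfl
  intro i _
  simp [hz]

lemma frob_le {m : ℕ} (A : Matrix (Fin m) (Fin m) ℂ) (B : ℝ) (hB : 0 ≤ B)
    (h : ∀ i j, ‖A i j‖ ≤ B) : frobNorm A ≤ m * B := by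
  unfold frobNorm
  apply Real.sqrt_le_iff.2 ⟨by positivity, ?_⟩
  calc ∑ i, ∑ j, ‖A i j‖ ^ 2 ≤ ∑ _i : Fin m, ∑ _j : Fin m, B ^ 2 := by
        gcongr with i _ j _; exact h i j
    _ = (m * B) ^ 2 := by simp; ring

lemma cond_le (n : ℕ) (hn : 0 < n) (M L : ℤ) (H : Good2 n M L)
    (ζ : Fin n.totient → ℂ) (hζ : ∀ i, IsPrimitiveRoot (ζ i) n)
    (hinj : Function.Injective ζ) :
    condNum (Matrix.of fun i j : Fin n.totient => ζ i ^ (j : ℕ)) ≤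
      n.totient * (n.totient * (M * L / n)) := by
  obtain ⟨hM, P, hP, hL⟩ := H
  have hn0 : (n : ℂ) ≠ 0 := by exact_mod_cast hn.ne'
  have hnorm : ∀ i, ‖ζ i‖ = 1 := fun i => (hζ i).norm'_eq_one hn.ne'
  have hML : (0 : ℝ) ≤ M * L / n := by
    have h1 : (0 : ℝ) ≤ M := by exact_mod_cast (l1_nonneg _).trans hM
    have h2 : (0 : ℝ) ≤ L := by exact_mod_cast (l1_nonneg _).trans hL
    positivity
  set φ : ℂ[X] := (cyclotomic n ℤ).map (Int.castRingHom ℂ) with hφ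
  set ψ : ℂ[X] := P.map (Int.castRingHom ℂ) with hψ
  have hφc : φ = cyclotomic n ℂ := map_cyclotomic _ _
  have hφψ : φ * ψ = X ^ n - 1 := by
    rw [hφ, hψ, ← Polynomial.map_mul, hP]; simp
  have hdeg : φ.natDegree = n.totient := by rw [hφc, natDegree_cyclotomic]
  have hroot : ∀ i, φ.IsRoot (ζ i) := fun i => by
    rw [hφc]; exact (hζ i).isRoot_cyclotomic hn
  set Q : Fin n.totient → ℂ[X] := fun i => φ /ₘ (X - C (ζ i)) with hQ
  have hmul : ∀ i, (X - C (ζ i)) * Q i = φ := fun i => mul_divByMonic_eq_iff_isRoot.2 (hroot i)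
  set W : Matrix (Fin n.totient) (Fin n.totient) ℂ :=
    Matrix.of fun j i => (Q i).coeff j * (ζ i * ψ.eval (ζ i) / n) with hW
  have hQdeg : ∀ i, (Q i).natDegree < n.totient := fun i => by
    rw [hQ]
    simp only [natDegree_divByMonic _ (monic_X_sub_C (ζ i)), hdeg, natDegree_X_sub_C]
    have := Nat.totient_pos.2 hn
    omega
  have hVW : (Matrix.of fun i j : Fin n.totient => ζ i ^ (j : ℕ)) * W = 1 := by
    ext k i
    have e1 : ((Matrix.of fun i j : Fin n.totient => ζ i ^ (j : ℕ)) * W) k i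
        = (Q i).eval (ζ k) * (ζ i * ψ.eval (ζ i) / n) := by
      rw [Matrix.mul_apply, eval_eq_sum_range' (hQdeg i), Finset.sum_range, Finset.sum_mul]
      apply Finset.sum_congr rfl
      intro j _
      simp [hW]
      ring
    rw [e1]
    by_cases hki : k = i
    · subst hki
      rw [Matrix.one_apply_eq]
      have d1 : (derivative φ).eval (ζ k) = (Q k).eval (ζ k) := by
        rw [← hmul k]; simp
      have d2 := congrArg (fun f => (derivative f).eval (ζ k)) hφψ
      have hr : φ.eval (ζ k) = 0 := hroot k
      simp [hr, d1, derivative_X_pow] at d2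
      have hz : ζ k ^ (n - 1) * ζ k = 1 := by
        rw [← pow_succ, Nat.sub_add_cancel hn, (hζ k).pow_eq_one]
      field_simp
      linear_combination ζ k * d2 + n * hz
    · rw [Matrix.one_apply_ne hki]
      have := hroot k
      rw [← hmul i, IsRoot.def, eval_mul] at this
      have hne : eval (ζ k) (X - C (ζ i)) ≠ 0 := by
        simp [sub_ne_zero]; exact fun h => hki (hinj h)
      rw [(mul_eq_zero.1 this).resolve_left hne, zero_mul]
  unfold condNum
  rw [Matrix.inv_eq_right_inv hVW]
  apply mul_le_mul _ _ (Real.sqrt_nonneg _) (by positivity)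
  · have := frob_le (Matrix.of fun i j : Fin n.totient => ζ i ^ (j : ℕ)) 1 zero_le_one
      (fun i j => by simp [hnorm])
    simpa using this
  · apply frob_le _ _ hML
    intro j i
    have hMr : (l1 (cyclotomic n ℤ) : ℝ) ≤ M := by exact_mod_cast hM
    have hLr : (l1 P : ℝ) ≤ L := by exact_mod_cast hL
    have b1 := (norm_coeff_div_le (cyclotomic n ℤ) (ζ i) (hnorm i) j).trans hMr
    have b2 := (norm_eval_le P (ζ i) (hnorm i)).trans hLr
    simp only [hW, Matrix.of_apply, norm_mul, norm_div, hnorm, one_mul, Complex.norm_natCast]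
    rw [mul_div_assoc]
    have hMp := (norm_nonneg _).trans b1
    gcongr

lemma arith (u v w t : ℕ) (hu : 1 ≤ u) (huv : u < v) (hvw : v < w) (hw : 4 ≤ w) (ht : 6 ≤ t) :
    (((u * v * w + 1) * (4 * (u + 1)) * (4 * (u + 1) * (u * v + 1))) *
      (4 * (u + 1) * (u * v + 1) * (4 * (u + 1)))) ≤ 4 * (u * v * w * t) ^ 4 := by
  have h1 : u + 1 ≤ 2 * u := by omega
  have huv2 : 2 ≤ u * v := by nlinarith
  have h2 : 2 * (u * v + 1) ≤ 3 * (u * v) := by omega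
  have h3 : 8 * (u * v * w + 1) ≤ 9 * (u * v * w) := by nlinarith
  have ht4 : 1296 ≤ t ^ 4 := by
    calc 1296 = 6 ^ 4 := by norm_num
      _ ≤ t ^ 4 := by gcongr
  have hw3 : u ^ 3 ≤ w ^ 3 := by gcongr; omega
  have hkey : 2592 * u ^ 3 ≤ v * w ^ 3 * t ^ 4 := by
    calc 2592 * u ^ 3 = 2 * u ^ 3 * 1296 := by ring
      _ ≤ v * w ^ 3 * t ^ 4 := by gcongr; omega
  have hbig : (8 * (u * v * w + 1)) * (u + 1) ^ 4 * (2 * (u * v + 1)) ^ 2 ≤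
      (9 * (u * v * w)) * (2 * u) ^ 4 * (3 * (u * v)) ^ 2 := by gcongr
  have hk2 : 2592 * u ^ 3 * (u ^ 4 * v ^ 3 * w) ≤ v * w ^ 3 * t ^ 4 * (u ^ 4 * v ^ 3 * w) := by
    gcongr
  nlinarith [hbig, hk2]

lemma good4 (p q r s : ℕ) (hp : p.Prime) (hq : q.Prime) (hr : r.Prime) (hs : s.Prime)
    (n0 : ¬ q ∣ p) (n1 : ¬ r ∣ p * q) (n2 : ¬ s ∣ p * q * r) (h3 L3 : ℤ)
    (e1 : h3 = 4 * ((p.totient : ℤ) + 1))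
    (e2 : L3 = 4 * ((p.totient : ℤ) + 1) * (((p * q).totient : ℤ) + 1)) :
    Good (p * q * r * s) (L3 * h3) ((((p * q * r).totient : ℤ) + 1) * h3 * L3) := by
  have l2 : 1 < p * q := Nat.one_lt_mul_iff.2 ⟨hp.pos, hq.pos, Or.inl hp.one_lt⟩
  have l3 : 1 < p * q * r := Nat.one_lt_mul_iff.2 ⟨by omega, hr.pos, Or.inl l2⟩
  have g2 := good_step _ _ _ _ hp.one_lt hq n0 (good_prime _ hp)
  have g3 := good_step _ _ _ _ l2 hr n1 g2
  have f1 : ((p.totient : ℤ) + 1) * 1 * 2 * (2 * 1) = h3 := by rw [e1]; ring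
  have f2 : (((p * q).totient : ℤ) + 1) * (2 * 1) * (((p.totient : ℤ) + 1) * 1 * 2) = L3 := by
    rw [e2]; ring
  rw [f1, f2] at g3
  exact good_step _ _ _ _ l3 hs n2 g3

lemma good2_all (p q r s a b c d : ℕ) (hp : p.Prime) (hq : q.Prime) (hr : r.Prime)
    (hs : s.Prime) (ha : 1 ≤ a) (hb : 1 ≤ b) (hc : 1 ≤ c) (hd : 1 ≤ d) (M L : ℤ)
    (H : Good2 (p * q * r * s) M L) : Good2 (p ^ a * q ^ b * r ^ c * s ^ d) M L := by
  obtain ⟨a, rfl⟩ : ∃ k, a = k + 1 := ⟨a - 1, by omega⟩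
  obtain ⟨b, rfl⟩ : ∃ k, b = k + 1 := ⟨b - 1, by omega⟩
  obtain ⟨c, rfl⟩ : ∃ k, c = k + 1 := ⟨c - 1, by omega⟩
  obtain ⟨d, rfl⟩ : ∃ k, d = k + 1 := ⟨d - 1, by omega⟩
  have g1 := good2_pow _ p M L hp ⟨q * r * s, by ring⟩ H a
  have g2 := good2_pow _ q M L hq ⟨p * r * s * p ^ a, by ring⟩ g1 b
  have g3 := good2_pow _ r M L hr ⟨p * q * s * p ^ a * q ^ b, by ring⟩ g2 c
  have g4 := good2_pow _ s M L hs ⟨p * q * r * p ^ a * q ^ b * r ^ c, by ring⟩ g3 d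
  have e : p * q * r * s * p ^ a * q ^ b * r ^ c * s ^ d =
      p ^ (a + 1) * q ^ (b + 1) * r ^ (c + 1) * s ^ (d + 1) := by ring
  rwa [e] at g4

end CycCond

theorem condNum_vandermonde_four_primes (p q r s a b c d : ℕ)
    (hp : Nat.Prime p) (hq : Nat.Prime q) (hr : Nat.Prime r) (hs : Nat.Prime s)
    (hpq : p < q) (hqr : q < r) (hrs : r < s)
    (ha : 1 ≤ a) (hb : 1 ≤ b) (hc : 1 ≤ c) (hd : 1 ≤ d)
    (n : ℕ) (hn : n = p ^ a * q ^ b * r ^ c * s ^ d)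
    (ζ : Fin n.totient → ℂ) (hζ : ∀ i, IsPrimitiveRoot (ζ i) n)
    (hinj : Function.Injective ζ) :
    condNum (Matrix.of fun i j : Fin n.totient => ζ i ^ (j : ℕ)) ≤
      4 * ((p * q * r * s).totient : ℝ) ^ 4 * (n.totient : ℝ) ^ 2 := by
  
  have hp2 := hp.two_le
  have hr5 : 5 ≤ r := by
    have : r ≠ 4 := by rintro rfl; norm_num at hr
    omega
  have hs7 : 7 ≤ s := by
    have : s ≠ 6 := by rintro rfl; norm_num at hs
    omega
  have npq : ¬ q ∣ p := fun h => by have := Nat.le_of_dvd hp.pos h; omega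
  have npr : ¬ r ∣ p := fun h => by have := Nat.le_of_dvd hp.pos h; omega
  have nps : ¬ s ∣ p := fun h => by have := Nat.le_of_dvd hp.pos h; omega
  have nqr : ¬ r ∣ q := fun h => by have := Nat.le_of_dvd hq.pos h; omega
  have nqs : ¬ s ∣ q := fun h => by have := Nat.le_of_dvd hq.pos h; omega
  have nrs : ¬ s ∣ r := fun h => by have := Nat.le_of_dvd hr.pos h; omega
  have n1 : ¬ r ∣ p * q := by rw [hr.dvd_mul]; tauto
  have n2 : ¬ s ∣ p * q * r := by rw [hs.dvd_mul, hs.dvd_mul]; tauto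
  have c0 : p.Coprime q := ((Nat.Prime.coprime_iff_not_dvd hq).2 npq).symm
  have c1 : (p * q).Coprime r := ((Nat.Prime.coprime_iff_not_dvd hr).2 n1).symm
  have c2 : (p * q * r).Coprime s := ((Nat.Prime.coprime_iff_not_dvd hs).2 n2).symm
  obtain ⟨u, hu⟩ : ∃ u, p = u + 1 := ⟨p - 1, by omega⟩
  obtain ⟨v, hv⟩ : ∃ v, q = v + 1 := ⟨q - 1, by omega⟩
  obtain ⟨w, hw⟩ : ∃ w, r = w + 1 := ⟨r - 1, by omega⟩
  obtain ⟨t, ht⟩ : ∃ t, s = t + 1 := ⟨s - 1, by omega⟩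
  have tp : p.totient = u := by rw [Nat.totient_prime hp]; omega
  have tq : q.totient = v := by rw [Nat.totient_prime hq]; omega
  have tr : r.totient = w := by rw [Nat.totient_prime hr]; omega
  have ts : s.totient = t := by rw [Nat.totient_prime hs]; omega
  have tpq : (p * q).totient = u * v := by rw [Nat.totient_mul c0, tp, tq]
  have tpqr : (p * q * r).totient = u * v * w := by rw [Nat.totient_mul c1, tpq, tr]
  have tR : (p * q * r * s).totient = u * v * w * t := by rw [Nat.totient_mul c2, tpqr, ts]
  have g := (CycCond.good4 p q r s hp hq hr hs npq n1 n2 _ _ rfl rfl).good2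
  have gn := CycCond.good2_all p q r s a b c d hp hq hr hs ha hb hc hd _ _ g
  rw [← hn] at gn
  have hdvd : p * q * r * s ∣ n := by
    rw [hn]
    exact mul_dvd_mul (mul_dvd_mul (mul_dvd_mul (dvd_pow_self p (by omega))
      (dvd_pow_self q (by omega))) (dvd_pow_self r (by omega))) (dvd_pow_self s (by omega))
  have hn0 : 0 < n := by
    rw [hn]
    have := hp.pos; have := hq.pos; have := hr.pos; have := hs.pos
    positivity
  have hle := Nat.le_of_dvd hn0 hdvd
  have hR1 : 1 < p * q * r * s := by
    have := Nat.le_of_dvd (Nat.pos_of_ne_zero (fun h => by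
      rw [h] at hdvd; have := Nat.eq_zero_of_zero_dvd hdvd; omega)) (Dvd.intro_left (p * q * r) rfl : s ∣ p * q * r * s)
    omega
  have hlt := Nat.totient_lt _ hR1
  have hC := CycCond.cond_le n hn0 _ _ gn ζ hζ hinj
  have har := CycCond.arith u v w t (by omega) (by omega) (by omega) (by omega) (by omega)
  refine hC.trans ?_
  rw [tR] at hlt ⊢
  rw [tp, tpq, tpqr]
  have hnr : (((u * v * w * t : ℕ) : ℝ) + 1) ≤ n := by exact_mod_cast (by omega : u * v * w * t + 1 ≤ n)
  have hnpos : (0 : ℝ) < n := by exact_mod_cast hn0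
  have harr : ((((u * v * w + 1) * (4 * (u + 1)) * (4 * (u + 1) * (u * v + 1))) *
      (4 * (u + 1) * (u * v + 1) * (4 * (u + 1)))) : ℝ) ≤ 4 * (((u * v * w * t : ℕ) : ℝ)) ^ 4 := by
    exact_mod_cast har
  have hfin : ∀ X Y Z T N m : ℝ, 0 ≤ Z → 0 < N → T + 1 ≤ N → X * Y ≤ Z →
      0 ≤ X → 0 ≤ Y → 0 ≤ T → m * (m * ((T + 1) * Y * X / N)) ≤ Z * m ^ 2 := by
    intro X Y Z T N m hZ hN hT hXY hX hY hT0
    have h1 : (T + 1) * Y * X / N ≤ Z := by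
      rw [div_le_iff₀ hN]
      have := mul_nonneg hX hY
      nlinarith
    nlinarith [sq_nonneg m]
  push_cast at harr hnr ⊢
  exact hfin _ _ _ _ _ _ (by positivity) hnpos hnr harr (by positivity) (by positivity)
    (by positivity)
end

section
/- Let n = p^a q^b r^c s^d t^e with p < q < r < s < t distinct primes and a, b, c, d, e ≥ 1, and set m = φ(n). Then Cond(V_{Φ_n}) ≤ 4 · φ(rad(n))⁷ · m². -/
open Polynomial in
/-- Height bound. -/
def HtB (f : ℤ[X]) (a : ℕ) : Prop := ∀ k, |f.coeff k| ≤ (a : ℤ)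

open Polynomial in
/-- Coefficient bounds for the cyclotomic polynomial and its cofactor. -/
def CycB (M a b : ℕ) : Prop :=
  ∃ G : ℤ[X], cyclotomic M ℤ * G = X ^ M - 1 ∧ HtB (cyclotomic M ℤ) a ∧ HtB G b

lemma sum_mult_aux (p k : ℕ) (hp : 0 < p) (g h : ℕ → ℤ) :
    ∑ i ∈ Finset.range (k + 1), (if p ∣ i then g (i / p) else 0) * h (k - i)
      = ∑ i ∈ Finset.range (k / p + 1), g i * h (k - p * i) := by
  simp only [ite_mul, zero_mul]
  rw [← Finset.sum_filter]
  refine Finset.sum_nbij' (fun i => i / p) (fun i => p * i) ?_ ?_ ?_ ?_ ?_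
  · intro i hi
    simp only [Finset.mem_filter, Finset.mem_range] at hi ⊢
    exact Nat.lt_succ_of_le (Nat.div_le_div_right (by omega))
  · intro i hi
    simp only [Finset.mem_filter, Finset.mem_range] at hi ⊢
    refine ⟨?_, dvd_mul_right _ _⟩
    have : i ≤ k / p := by omega
    have := (Nat.le_div_iff_mul_le hp).1 this
    rw [mul_comm]; omega
  · intro i hi
    simp only [Finset.mem_filter, Finset.mem_range] at hi
    exact Nat.mul_div_cancel' hi.2
  · intro i _
    exact Nat.mul_div_cancel_left i hp
  · intro i hi
    simp only [Finset.mem_filter, Finset.mem_range] at hi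
    rw [Nat.mul_div_cancel' hi.2]

open Polynomial in
lemma coeff_expand_mul_poly (p k : ℕ) (hp : 0 < p) (F G : ℤ[X]) :
    (expand ℤ p F * G).coeff k
      = ∑ i ∈ Finset.range (k / p + 1), F.coeff i * G.coeff (k - p * i) := by
  rw [coeff_mul, Finset.Nat.sum_antidiagonal_eq_sum_range_succ_mk]
  simp only [coeff_expand hp]
  exact sum_mult_aux p k hp F.coeff G.coeff

open Polynomial in
lemma cofactor_natDegree (M : ℕ) (hM : 2 ≤ M) (G : ℤ[X])
    (hG : cyclotomic M ℤ * G = X ^ M - 1) : G.natDegree < M := by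
  have h1 : (X ^ M - 1 : ℤ[X]).natDegree = M := by
    simpa using natDegree_X_pow_sub_C (n := M) (r := (1 : ℤ))
  have h0 : G ≠ 0 := by
    rintro rfl
    rw [← hG] at h1
    simp at h1
    omega
  rw [← hG, natDegree_mul (cyclotomic_ne_zero M ℤ) h0, natDegree_cyclotomic] at h1
  have := Nat.totient_pos.2 (show 0 < M by omega)
  omega

open Polynomial in
lemma coeff_cyclotomic_step (M p : ℕ) (hM : 2 ≤ M) (hp : p.Prime) (hpM : ¬ p ∣ M) (G : ℤ[X])
    (hG : cyclotomic M ℤ * G = X ^ M - 1) (k : ℕ) :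
    (cyclotomic (M * p) ℤ).coeff k
      = - ∑ i ∈ Finset.range (k / p + 1), (cyclotomic M ℤ).coeff i * G.coeff ((k - p * i) % M) := by
  have hdeg := cofactor_natDegree M hM G hG
  have hexp := cyclotomic_expand_eq_cyclotomic_mul hp hpM ℤ
  have e1 : cyclotomic (M * p) ℤ * (X ^ M - 1) = expand ℤ p (cyclotomic M ℤ) * G := by
    rw [hexp, ← hG]; ring
  set U : PowerSeries ℤ := PowerSeries.mk (fun j => G.coeff (j % M)) with hU
  have e2 : (G : PowerSeries ℤ) = U * (1 - PowerSeries.X ^ M) := by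
    ext j
    rw [mul_sub, mul_one, map_sub, PowerSeries.coeff_mul_X_pow', Polynomial.coeff_coe, hU]
    simp only [PowerSeries.coeff_mk]
    split_ifs with h
    · rw [← Nat.mod_eq_sub_mod h, sub_self]
      exact coeff_eq_zero_of_natDegree_lt (by omega)
    · rw [Nat.mod_eq_of_lt (by omega), sub_zero]
  have e3 : ((cyclotomic (M * p) ℤ : ℤ[X]) : PowerSeries ℤ)
      = - (((expand ℤ p (cyclotomic M ℤ) : ℤ[X]) : PowerSeries ℤ) * U) := by
    have e4 := congrArg (fun f : ℤ[X] => (f : PowerSeries ℤ)) e1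
    simp only [Polynomial.coe_mul, Polynomial.coe_sub, Polynomial.coe_pow, Polynomial.coe_X,
      Polynomial.coe_one] at e4
    rw [e2] at e4
    have hne : (1 - PowerSeries.X ^ M : PowerSeries ℤ) ≠ 0 := by
      intro h
      have := congrArg (PowerSeries.coeff 0) h
      simp [PowerSeries.coeff_zero_eq_constantCoeff, show M ≠ 0 by omega] at this
    apply mul_right_cancel₀ hne
    linear_combination -e4
  have e5 := congrArg (PowerSeries.coeff k) e3
  rw [Polynomial.coeff_coe, map_neg, PowerSeries.coeff_mul,
    Finset.Nat.sum_antidiagonal_eq_sum_range_succ_mk] at e5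
  rw [e5]
  simp only [Polynomial.coeff_coe, coeff_expand hp.pos, hU, PowerSeries.coeff_mk]
  rw [sum_mult_aux p k hp.pos (cyclotomic M ℤ).coeff (fun j => G.coeff (j % M))]

open Polynomial in
lemma cofactor_step (M p : ℕ) (hp : p.Prime) (hpM : ¬ p ∣ M) (G : ℤ[X])
    (hG : cyclotomic M ℤ * G = X ^ M - 1) :
    cyclotomic (M * p) ℤ * (expand ℤ p G * cyclotomic M ℤ) = X ^ (M * p) - 1 := by
  have hexp := cyclotomic_expand_eq_cyclotomic_mul hp hpM ℤ
  have h := congrArg (expand ℤ p) hG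
  rw [map_mul, hexp] at h
  simp only [map_sub, map_pow, expand_X, map_one, ← pow_mul] at h
  rw [mul_comm M p, ← h, mul_comm p M]; ring

open Polynomial in
lemma cofactor_bound (M p a b : ℕ) (hp : p.Prime) (G : ℤ[X])
    (hF : HtB (cyclotomic M ℤ) a) (hG : HtB G b) :
    HtB (expand ℤ p G * cyclotomic M ℤ) (a * b * (M.totient / p + 1)) := by
  intro k
  rw [coeff_expand_mul_poly p k hp.pos]
  have hpos := hp.pos
  rw [← Finset.sum_filter_of_ne (p := fun i => k - p * i ≤ M.totient)]
  · refine (Finset.abs_sum_le_sum_abs _ _).trans ?_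
    refine (Finset.sum_le_card_nsmul _ _ ((a * b : ℕ) : ℤ) ?_).trans ?_
    · intro i _
      rw [abs_mul, mul_comm]
      push_cast
      exact mul_le_mul (hF _) (hG _) (abs_nonneg _) (by positivity)
    · have hc : (Finset.filter (fun i => k - p * i ≤ M.totient)
          (Finset.range (k / p + 1))).card ≤ M.totient / p + 1 := by
        rw [← Finset.card_range (M.totient / p + 1)]
        refine Finset.card_le_card_of_injOn (fun i => (k - p * i) / p) ?_ ?_
        · intro i hi
          simp only [Finset.coe_filter, Finset.mem_range, Set.mem_ofPred_eq, Finset.coe_range,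
            Set.mem_Iio] at hi ⊢
          exact Nat.lt_succ_of_le (Nat.div_le_div_right hi.2)
        · intro i hi j hj hij
          simp only [Finset.coe_filter, Finset.mem_range, Set.mem_ofPred_eq] at hi hj hij
          rw [Nat.sub_mul_div, Nat.sub_mul_div] at hij
          omega
      rw [nsmul_eq_mul, mul_comm]
      have : ((a * b : ℕ) : ℤ) * ((Finset.filter (fun i => k - p * i ≤ M.totient)
          (Finset.range (k / p + 1))).card : ℤ) ≤ ((a * b : ℕ) : ℤ) * ((M.totient / p + 1 : ℕ) : ℤ) :=
        mul_le_mul_of_nonneg_left (by exact_mod_cast hc) (by positivity)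
      exact_mod_cast this
  · intro i _ hne
    by_contra hlt
    apply hne
    rw [coeff_eq_zero_of_natDegree_lt (p := cyclotomic M ℤ), mul_zero]
    rw [natDegree_cyclotomic]; omega

open Polynomial in
lemma cyclotomic_bound (M p a b : ℕ) (hM : 2 ≤ M) (hp : p.Prime) (hpM : ¬ p ∣ M) (G : ℤ[X])
    (hG : cyclotomic M ℤ * G = X ^ M - 1)
    (hF : HtB (cyclotomic M ℤ) a) (hGb : HtB G b) :
    HtB (cyclotomic (M * p) ℤ) (a * b * M.totient) := by
  intro k
  by_cases hk : (M * p).totient < k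
  · rw [coeff_eq_zero_of_natDegree_lt (by rw [natDegree_cyclotomic]; exact hk)]
    simp only [abs_zero]; positivity
  rw [coeff_cyclotomic_step M p hM hp hpM G hG, abs_neg]
  refine (Finset.abs_sum_le_sum_abs _ _).trans ?_
  refine (Finset.sum_le_card_nsmul _ _ ((a * b : ℕ) : ℤ) ?_).trans ?_
  · intro i _
    rw [abs_mul]
    push_cast
    exact mul_le_mul (hF _) (hGb _) (abs_nonneg _) (by positivity)
  · have hc : k / p + 1 ≤ M.totient := by
      have h1 : (M * p).totient = M.totient * (p - 1) := by
        rw [Nat.totient_mul ((Nat.Prime.coprime_iff_not_dvd hp).2 hpM).symm, Nat.totient_prime hp]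
      have h2 := Nat.totient_pos.2 (show 0 < M by omega)
      have : k / p < M.totient := by
        rw [Nat.div_lt_iff_lt_mul hp.pos]
        have : M.totient * (p - 1) < M.totient * p :=
          Nat.mul_lt_mul_of_pos_left (by have := hp.pos; omega) h2
        omega
      omega
    rw [Finset.card_range, nsmul_eq_mul, mul_comm]
    have : ((a * b : ℕ) : ℤ) * ((k / p + 1 : ℕ) : ℤ) ≤ ((a * b : ℕ) : ℤ) * ((M.totient : ℕ) : ℤ) :=
      mul_le_mul_of_nonneg_left (by exact_mod_cast hc) (by positivity)
    exact_mod_cast this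

lemma cycB_step (M p a b : ℕ) (hM : 2 ≤ M) (hp : p.Prime) (hpM : ¬ p ∣ M) (h : CycB M a b) :
    CycB (M * p) (a * b * M.totient) (a * b * (M.totient / p + 1)) := by
  obtain ⟨G, hG, hF, hGb⟩ := h
  exact ⟨_, cofactor_step M p hp hpM G hG, cyclotomic_bound M p a b hM hp hpM G hG hF hGb,
    cofactor_bound M p a b hp G hF hGb⟩

open Polynomial in
lemma coeff_cyc_prime (p : ℕ) (hp : p.Prime) (k : ℕ) :
    (cyclotomic p ℤ).coeff k = if k < p then 1 else 0 := by
  have := Fact.mk hp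
  rw [cyclotomic_prime, finsetSum_coeff]
  simp [coeff_X_pow]

open Polynomial in
lemma coeff_X_sub_one (k : ℕ) :
    (X - 1 : ℤ[X]).coeff k = (if k = 1 then 1 else 0) - (if k = 0 then 1 else 0) := by
  rw [coeff_sub, coeff_X, coeff_one]
  simp [eq_comm]

lemma residue_card (p q k c : ℕ) (hp : p.Prime) (hq : q.Prime) (hpq : p < q) :
    ((Finset.range (k / q + 1)).filter (fun i => i < p ∧ (k - q * i) % p = c)).card ≤ 1 := by
  rw [Finset.card_le_one]
  have key : ∀ i j, i ≤ j → j ≤ k / q → j < p → (k - q * i) % p = (k - q * j) % p → i = j := by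
    intro i j hij hjk hjp h
    have h1 : q * j ≤ k := by rw [mul_comm]; exact (Nat.le_div_iff_mul_le hq.pos).1 hjk
    have h2 : q * i ≤ q * j := Nat.mul_le_mul_left q hij
    have h3 : p ∣ (k - q * i) - (k - q * j) := (Nat.modEq_iff_dvd' (by omega)).1 h.symm
    have h4 : (k - q * i) - (k - q * j) = q * (j - i) := by
      rw [Nat.mul_sub]; omega
    rw [h4] at h3
    rcases (Nat.Prime.dvd_mul hp).1 h3 with h5 | h5
    · rw [Nat.prime_dvd_prime_iff_eq hp hq] at h5; omega
    · by_contra hne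
      have := Nat.le_of_dvd (by omega) h5
      omega
  intro i hi j hj
  simp only [Finset.mem_filter, Finset.mem_range] at hi hj
  rcases le_total i j with h | h
  · exact key i j h (by omega) (by omega) (by omega)
  · exact (key j i h (by omega) (by omega) (by omega)).symm

open Polynomial in
lemma cycB_two (p q : ℕ) (hp : p.Prime) (hq : q.Prime) (hpq : p < q) : CycB (p * q) 1 1 := by
  have hp2 := hp.two_le
  have hqp : ¬ q ∣ p := fun h => by have := Nat.le_of_dvd hp.pos h; omega
  have hG : cyclotomic p ℤ * (X - 1) = X ^ p - 1 := by
    have := Fact.mk hp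
    exact cyclotomic_prime_mul_X_sub_one ℤ p
  have hF1 : HtB (cyclotomic p ℤ) 1 := by
    intro k; rw [coeff_cyc_prime p hp]; split_ifs <;> simp
  have hG1 : HtB (X - 1 : ℤ[X]) 1 := by
    intro k; rw [coeff_X_sub_one]; split_ifs <;> first | omega | simp
  refine ⟨_, cofactor_step p q hq hqp _ hG, ?_, ?_⟩
  · intro k
    rw [coeff_cyclotomic_step p q hp2 hq hqp _ hG]
    have e : ∀ i ∈ Finset.range (k / q + 1),
        (cyclotomic p ℤ).coeff i * (X - 1 : ℤ[X]).coeff ((k - q * i) % p)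
        = (if i < p ∧ (k - q * i) % p = 1 then 1 else 0)
          - (if i < p ∧ (k - q * i) % p = 0 then 1 else 0) := by
      intro i _
      rw [coeff_cyc_prime p hp, coeff_X_sub_one]
      by_cases h : i < p <;> simp [h]
    rw [Finset.sum_congr rfl e, Finset.sum_sub_distrib, Finset.sum_boole, Finset.sum_boole]
    have h0 := residue_card p q k 0 hp hq hpq
    have h1 := residue_card p q k 1 hp hq hpq
    rw [abs_le]
    push_cast
    constructor <;> omega
  · have := cofactor_bound p q 1 1 hq _ hF1 hG1
    rw [Nat.totient_prime hp, Nat.div_eq_of_lt (by omega)] at this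
    simpa using this

open Polynomial in
lemma cyclotomic_expand_rad (k : ℕ) : k ≠ 0 → ∀ M : ℕ, (∀ p : ℕ, p.Prime → p ∣ k → p ∣ M) →
    expand ℤ k (cyclotomic M ℤ) = cyclotomic (M * k) ℤ := by
  induction k using induction_on_primes with
  | zero => intro h; exact absurd rfl h
  | one => intro _ M _; simp
  | prime_mul p k hp ih =>
    intro h M hM
    have hk : k ≠ 0 := by rintro rfl; simp at h
    rw [← expand_expand, ih hk M (fun l hl hlk => hM l hl (hlk.mul_left p)),
      cyclotomic_expand_eq_cyclotomic hp ((hM p hp (dvd_mul_right p k)).mul_right k)]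
    congr 1; ring

open Polynomial in
lemma expand_sum_bound (F : ℤ[X]) (k a : ℕ) (hk : 0 < k) (hF : HtB F a) (S : Finset ℕ) :
    ∑ i ∈ S, |(expand ℤ k F).coeff i| ≤ (((F.natDegree + 1) * a : ℕ) : ℤ) := by
  rw [← Finset.sum_filter_of_ne (p := fun i => k ∣ i ∧ i / k ≤ F.natDegree)]
  · refine (Finset.sum_le_card_nsmul _ _ (a : ℤ) ?_).trans ?_
    · intro i _
      rw [coeff_expand hk]
      split_ifs
      · exact hF _
      · simp
    · have hc : (Finset.filter (fun i => k ∣ i ∧ i / k ≤ F.natDegree) S).card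
          ≤ F.natDegree + 1 := by
        rw [← Finset.card_range (F.natDegree + 1)]
        refine Finset.card_le_card_of_injOn (fun i => i / k) ?_ ?_
        · intro i hi
          simp only [Finset.coe_filter, Set.mem_ofPred_eq, Finset.coe_range,
            Set.mem_Iio] at hi ⊢
          omega
        · intro i hi j hj hij
          simp only [Finset.coe_filter, Set.mem_ofPred_eq] at hi hj hij
          rw [← Nat.div_mul_cancel hi.2.1, ← Nat.div_mul_cancel hj.2.1, hij]
      rw [nsmul_eq_mul]
      push_cast
      exact mul_le_mul_of_nonneg_right (by exact_mod_cast hc) (by positivity)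
  · intro i _ hne
    rw [coeff_expand hk] at hne
    by_cases h : k ∣ i
    · refine ⟨h, ?_⟩
      by_contra hlt
      apply hne
      rw [if_pos h, coeff_eq_zero_of_natDegree_lt (by omega), abs_zero]
    · simp [h] at hne

open Polynomial in
lemma vandermonde_inv_bound (n A b : ℕ) (hn : 2 ≤ n) (G : ℤ[X])
    (hG : cyclotomic n ℤ * G = X ^ n - 1)
    (hA : ∀ S : Finset ℕ, ∑ i ∈ S, |(cyclotomic n ℤ).coeff i| ≤ (A : ℤ)) (hb : HtB G b)
    (ζ : Fin n.totient → ℂ) (hζ : ∀ i, IsPrimitiveRoot (ζ i) n)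
    (hinj : Function.Injective ζ) (i j : Fin n.totient) :
    ‖(Matrix.of fun i j : Fin n.totient => ζ i ^ (j : ℕ))⁻¹ i j‖ ≤ (A : ℝ) * b := by
  set V : Matrix (Fin n.totient) (Fin n.totient) ℂ :=
    Matrix.of fun i j : Fin n.totient => ζ i ^ (j : ℕ) with hV
  have hn0 : (n : ℂ) ≠ 0 := by exact_mod_cast (show n ≠ 0 by omega)
  have : NeZero (n : ℂ) := ⟨hn0⟩
  set P : ℂ[X] := cyclotomic n ℂ with hP
  set g : ℂ[X] := G.map (Int.castRingHom ℂ) with hg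
  have hPg : P * g = X ^ n - 1 := by
    have := congrArg (Polynomial.map (Int.castRingHom ℂ)) hG
    simpa [map_cyclotomic] using this
  have hroot : ∀ i, P.eval (ζ i) = 0 := fun i => (isRoot_cyclotomic_iff.2 (hζ i))
  have hfac : ∀ j, (X - C (ζ j)) * (P /ₘ (X - C (ζ j))) = P := fun j =>
    mul_divByMonic_eq_iff_isRoot.2 (hroot j)
  have hnorm : ∀ i, ‖ζ i‖ = 1 := fun i => (hζ i).norm'_eq_one (by omega)
  set c : Fin n.totient → ℂ := fun j => g.eval (ζ j) * ζ j / n with hc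
  set W : Matrix (Fin n.totient) (Fin n.totient) ℂ :=
    Matrix.of fun k j => (P /ₘ (X - C (ζ j))).coeff k * c j with hW
  have hdiag : ∀ j, (P /ₘ (X - C (ζ j))).eval (ζ j) * c j = 1 := by
    intro j
    have h1 : (X - C (ζ j)) * ((P /ₘ (X - C (ζ j))) * g) = X ^ n - 1 := by
      rw [← mul_assoc, hfac, hPg]
    have h2 := congrArg (fun f : ℂ[X] => (derivative f).eval (ζ j)) h1
    simp only [derivative_mul, derivative_sub, derivative_X, derivative_C, derivative_X_pow,
      derivative_one, eval_add, eval_mul, eval_sub, eval_X, eval_C, eval_pow,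
      sub_self, zero_mul, add_zero, sub_zero, eval_one, one_mul] at h2
    have h3 : ζ j ^ (n - 1) * ζ j = 1 := by
      rw [← pow_succ, Nat.sub_add_cancel (by omega)]; exact (hζ j).pow_eq_one
    simp only [hc]
    field_simp
    rw [h2, mul_assoc, h3, mul_one]
  have hVW : V * W = 1 := by
    ext i j
    rw [Matrix.mul_apply]
    have hdeg : (P /ₘ (X - C (ζ j))).natDegree < n.totient := by
      rw [natDegree_divByMonic _ (monic_X_sub_C _), natDegree_X_sub_C, hP, natDegree_cyclotomic]
      have := i.2
      omega
    have e : ∑ k, V i k * W k j = (P /ₘ (X - C (ζ j))).eval (ζ i) * c j := by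
      rw [eval_eq_sum_range' hdeg, Finset.sum_mul,
        ← Fin.sum_univ_eq_sum_range (fun k => (P /ₘ (X - C (ζ j))).coeff k * ζ i ^ k * c j)]
      refine Finset.sum_congr rfl fun k _ => ?_
      simp only [hV, hW, Matrix.of_apply]
      ring
    rw [e]
    by_cases hij : i = j
    · subst hij; rw [hdiag, Matrix.one_apply_eq]
    · rw [Matrix.one_apply_ne hij]
      have h1 := congrArg (eval (ζ i)) (hfac j)
      rw [eval_mul, hroot i] at h1
      rcases mul_eq_zero.1 h1 with h | h
      · exfalso
        simp only [eval_sub, eval_X, eval_C] at h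
        exact hij (hinj (sub_eq_zero.1 h))
      · rw [h, zero_mul]
  rw [Matrix.inv_eq_right_inv hVW]
  simp only [hW, Matrix.of_apply]
  rw [norm_mul]
  refine mul_le_mul ?_ ?_ (norm_nonneg _) (by positivity)
  · rw [coeff_divByMonic_X_sub_C]
    refine (norm_sum_le _ _).trans ?_
    have h1 := hA (Finset.Icc ((i : ℕ) + 1) P.natDegree)
    have h2 : ((∑ l ∈ Finset.Icc ((i : ℕ) + 1) P.natDegree, |(cyclotomic n ℤ).coeff l| : ℤ) : ℝ)
        ≤ ((A : ℤ) : ℝ) := by exact_mod_cast h1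
    push_cast at h2
    refine le_trans (le_of_eq ?_) h2
    refine Finset.sum_congr rfl fun l _ => ?_
    rw [norm_mul, norm_pow, hnorm, one_pow, one_mul, hP, ← map_cyclotomic_int, coeff_map]
    simp
  · simp only [hc]
    rw [norm_div, norm_mul, hnorm, mul_one, Complex.norm_natCast]
    have hn' : (0 : ℝ) < n := by exact_mod_cast (show 0 < n by omega)
    rw [div_le_iff₀ hn']
    have hdeg : g.natDegree < n :=
      lt_of_le_of_lt natDegree_map_le (cofactor_natDegree n hn G hG)
    rw [eval_eq_sum_range' hdeg]
    refine (norm_sum_le _ _).trans ?_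
    refine (Finset.sum_le_card_nsmul _ _ (b : ℝ) ?_).trans ?_
    · intro l _
      rw [norm_mul, norm_pow, hnorm, one_pow, mul_one, hg, coeff_map]
      have := hb l
      have h2 : ((|G.coeff l| : ℤ) : ℝ) ≤ ((b : ℤ) : ℝ) := by exact_mod_cast this
      simpa using h2
    · rw [Finset.card_range, nsmul_eq_mul, mul_comm]

lemma frob_le {m : ℕ} (A : Matrix (Fin m) (Fin m) ℂ) (c : ℝ) (hc : 0 ≤ c)
    (h : ∀ i j, ‖A i j‖ ≤ c) : frobNorm A ≤ m * c := by
  unfold frobNorm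
  refine Real.sqrt_le_iff.2 ⟨by positivity, ?_⟩
  have : ∑ i, ∑ j, ‖A i j‖ ^ 2 ≤ ∑ _i : Fin m, ∑ _j : Fin m, c ^ 2 :=
    Finset.sum_le_sum fun i _ => Finset.sum_le_sum fun j _ =>
      pow_le_pow_left₀ (norm_nonneg _) (h i j) 2
  refine this.trans (le_of_eq ?_)
  simp
  ring

lemma cycB_mono {M a b a' b' : ℕ} (h : CycB M a b) (ha : a ≤ a') (hb : b ≤ b') :
    CycB M a' b' := by
  obtain ⟨G, h1, h2, h3⟩ := h
  exact ⟨G, h1, fun k => (h2 k).trans (by exact_mod_cast ha),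
    fun k => (h3 k).trans (by exact_mod_cast hb)⟩

lemma div_aux (x y r : ℕ) (hx : 0 < x) (h : y < r) : x * y / r + 1 ≤ x := by
  have : x * y / r < x := by
    rw [Nat.div_lt_iff_lt_mul (by omega)]
    exact Nat.mul_lt_mul_of_pos_left h hx
  omega

lemma cycB_five (p q r s t : ℕ)
    (hp : Nat.Prime p) (hq : Nat.Prime q) (hr : Nat.Prime r) (hs : Nat.Prime s)
    (ht : Nat.Prime t) (hpq : p < q) (hqr : q < r) (hrs : r < s) (hst : s < t) :
    ∃ a b, CycB (p * q * r * s * t) a b ∧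
      ((p * q * r * s * t).totient + 1) * a * b ≤ 4 * (p * q * r * s * t).totient ^ 7 := by
  have nd : ∀ x y : ℕ, x.Prime → y.Prime → x < y → ¬ y ∣ x := fun x y hx hy h hd => by
    have := Nat.le_of_dvd hx.pos hd; omega
  have d2 : ¬ q ∣ p := nd _ _ hp hq hpq
  have d3 : ¬ r ∣ p * q := by
    rw [hr.dvd_mul]; exact not_or.2 ⟨nd _ _ hp hr (by omega), nd _ _ hq hr (by omega)⟩
  have d4 : ¬ s ∣ p * q * r := by
    rw [hs.dvd_mul, hs.dvd_mul]
    exact not_or.2 ⟨not_or.2 ⟨nd _ _ hp hs (by omega), nd _ _ hq hs (by omega)⟩,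
      nd _ _ hr hs (by omega)⟩
  have d5 : ¬ t ∣ p * q * r * s := by
    rw [ht.dvd_mul, ht.dvd_mul, ht.dvd_mul]
    exact not_or.2 ⟨not_or.2 ⟨not_or.2 ⟨nd _ _ hp ht (by omega), nd _ _ hq ht (by omega)⟩,
      nd _ _ hr ht (by omega)⟩, nd _ _ hs ht (by omega)⟩
  have tot : ∀ M x : ℕ, x.Prime → ¬ x ∣ M → (M * x).totient = M.totient * (x - 1) := by
    intro M x hx hd
    rw [Nat.totient_mul ((Nat.Prime.coprime_iff_not_dvd hx).2 hd).symm, Nat.totient_prime hx]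
  have t2 := tot p q hq d2
  have t3 := tot _ r hr d3
  have t4 := tot _ s hs d4
  have t5 := tot _ t ht d5
  rw [Nat.totient_prime hp] at t2
  rw [t2] at t3
  rw [t3] at t4
  rw [t4] at t5
  have m2 : 2 ≤ p * q := le_trans hp.two_le (Nat.le_mul_of_pos_right _ hq.pos)
  have m3 : 2 ≤ p * q * r := le_trans m2 (Nat.le_mul_of_pos_right _ hr.pos)
  have m4 : 2 ≤ p * q * r * s := le_trans m3 (Nat.le_mul_of_pos_right _ hs.pos)
  have c3 := cycB_step _ r 1 1 m2 hr d3 (cycB_two p q hp hq hpq)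
  rw [t2] at c3
  obtain ⟨P, rfl⟩ : ∃ P, p = P + 1 := ⟨p - 1, by have := hp.pos; omega⟩
  obtain ⟨Q, rfl⟩ : ∃ Q, q = Q + 1 := ⟨q - 1, by have := hq.pos; omega⟩
  obtain ⟨R, rfl⟩ : ∃ R, r = R + 1 := ⟨r - 1, by have := hr.pos; omega⟩
  obtain ⟨S, rfl⟩ : ∃ S, s = S + 1 := ⟨s - 1, by have := hs.pos; omega⟩
  obtain ⟨T, rfl⟩ : ∃ T, t = T + 1 := ⟨t - 1, by have := ht.pos; omega⟩
  simp only [Nat.add_sub_cancel] at *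
  have hP : 0 < P := by have := hp.two_le; omega
  have hQ : 0 < Q := by omega
  have hR : 0 < R := by omega
  have hS : 0 < S := by omega
  have hT : 0 < T := by omega
  have c3' := cycB_mono c3 (a' := P * Q) (b' := P) (by simp)
    (by simpa using div_aux P Q (R + 1) hP (by omega))
  have c4 := cycB_step _ (S + 1) _ _ m3 hs d4 c3'
  rw [t3] at c4
  have c4' := cycB_mono c4 (a' := P * Q * P * (P * Q * R)) (b' := P * Q * P * (P * Q)) le_rfl
    (Nat.mul_le_mul_left _ (div_aux (P * Q) R (S + 1) (by positivity) (by omega)))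
  have c5 := cycB_step _ (T + 1) _ _ m4 ht d5 c4'
  rw [t4] at c5
  have c5' := cycB_mono c5 le_rfl
    (Nat.mul_le_mul_left _ (div_aux (P * Q * R) S (T + 1) (by positivity) (by omega)))
  refine ⟨_, _, c5', ?_⟩
  rw [t5]
  have hphi : P * Q * R * S * T + 1 ≤ 2 * (P * Q * R * S * T) := by
    have : 0 < P * Q * R * S * T := by positivity
    omega
  have key : P ^ 8 * Q ^ 4 ≤ R ^ 2 * S ^ 5 * T ^ 6 := by
    calc P ^ 8 * Q ^ 4 = P ^ 2 * P ^ 5 * (P * Q ^ 4 * 1) := by ring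
      _ ≤ R ^ 2 * S ^ 5 * (T * T ^ 4 * T) := by
        gcongr <;> omega
      _ = _ := by ring
  calc _ ≤ 2 * (P * Q * R * S * T) * _ * _ := by gcongr
    _ = 2 * (P * Q * R * S * T) * (P ^ 6 * Q ^ 6 * R ^ 4 * S) * (P ^ 8 * Q ^ 4) := by ring
    _ ≤ 2 * (P * Q * R * S * T) * (P ^ 6 * Q ^ 6 * R ^ 4 * S) * (R ^ 2 * S ^ 5 * T ^ 6) := by
      gcongr
    _ = 2 * (P * Q * R * S * T) ^ 7 := by ring
    _ ≤ _ := by gcongr; norm_num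

open Polynomial in
lemma main_aux (p q r s t a b c d e : ℕ)
    (hp : Nat.Prime p) (hq : Nat.Prime q) (hr : Nat.Prime r) (hs : Nat.Prime s)
    (ht : Nat.Prime t)
    (hpq : p < q) (hqr : q < r) (hrs : r < s) (hst : s < t)
    (ha : 1 ≤ a) (hb : 1 ≤ b) (hc : 1 ≤ c) (hd : 1 ≤ d) (he : 1 ≤ e)
    (n : ℕ) (hn : n = p ^ a * q ^ b * r ^ c * s ^ d * t ^ e)
    (ζ : Fin n.totient → ℂ) (hζ : ∀ i, IsPrimitiveRoot (ζ i) n)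
    (hinj : Function.Injective ζ) :
    condNum (Matrix.of fun i j : Fin n.totient => ζ i ^ (j : ℕ)) ≤
      4 * ((p * q * r * s * t).totient : ℝ) ^ 7 * (n.totient : ℝ) ^ 2 := by
  obtain ⟨A, B, ⟨G, hG, hF, hB⟩, hAB⟩ := cycB_five p q r s t hp hq hr hs ht hpq hqr hrs hst
  set M := p * q * r * s * t with hM
  set k := p ^ (a - 1) * q ^ (b - 1) * r ^ (c - 1) * s ^ (d - 1) * t ^ (e - 1) with hk
  have hkpos : 0 < k := by
    have := hp.pos; have := hq.pos; have := hr.pos; have := hs.pos; have := ht.pos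
    positivity
  have hnk : n = M * k := by
    obtain ⟨a, rfl⟩ := Nat.exists_eq_add_of_le' ha
    obtain ⟨b, rfl⟩ := Nat.exists_eq_add_of_le' hb
    obtain ⟨c, rfl⟩ := Nat.exists_eq_add_of_le' hc
    obtain ⟨d, rfl⟩ := Nat.exists_eq_add_of_le' hd
    obtain ⟨e, rfl⟩ := Nat.exists_eq_add_of_le' he
    simp only [Nat.add_sub_cancel] at hk
    rw [hn, hM, hk]; ring
  have hdvd : ∀ l : ℕ, l.Prime → l ∣ k → l ∣ M := by
    intro l hl hlk
    rw [hk] at hlk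
    rw [hM]
    simp only [hl.dvd_mul] at hlk ⊢
    rcases hlk with (((h | h) | h) | h) | h <;> have := hl.dvd_of_dvd_pow h <;> tauto
  have hexp := cyclotomic_expand_rad k hkpos.ne' M hdvd
  rw [← hnk] at hexp
  have hM2 : 2 ≤ M := by
    have h1 : p ∣ M := ⟨q * r * s * t, by rw [hM]; ring⟩
    have hMpos : 0 < M := by
      have := hp.pos; have := hq.pos; have := hr.pos; have := hs.pos; have := ht.pos
      positivity
    exact hp.two_le.trans (Nat.le_of_dvd hMpos h1)
  have hn2 : 2 ≤ n := by
    rw [hnk]; exact hM2.trans (Nat.le_mul_of_pos_right _ hkpos)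
  have hG' : cyclotomic n ℤ * expand ℤ k G = X ^ n - 1 := by
    rw [← hexp, ← map_mul, hG, map_sub, map_pow, expand_X, map_one, ← pow_mul, hnk, mul_comm]
  have hA' : ∀ S : Finset ℕ, ∑ i ∈ S, |(cyclotomic n ℤ).coeff i|
      ≤ (((M.totient + 1) * A : ℕ) : ℤ) := by
    intro S
    have := expand_sum_bound (cyclotomic M ℤ) k A hkpos hF S
    rwa [hexp, natDegree_cyclotomic] at this
  have hB' : HtB (expand ℤ k G) B := by
    intro l
    rw [coeff_expand hkpos]
    split_ifs
    · exact hB _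
    · simp
  have hinv := vandermonde_inv_bound n _ B hn2 _ hG' hA' hB' ζ hζ hinj
  have h1 := frob_le _ _ (by positivity) hinv
  have h2 := frob_le (Matrix.of fun i j : Fin n.totient => ζ i ^ (j : ℕ)) 1 zero_le_one (by
    intro i j
    rw [Matrix.of_apply, norm_pow, (hζ i).norm'_eq_one (by omega), one_pow])
  have h3 : (((M.totient + 1) * A : ℕ) : ℝ) * B ≤ 4 * (M.totient : ℝ) ^ 7 := by
    exact_mod_cast hAB
  unfold condNum
  calc _ ≤ ((n.totient : ℝ) * 1) * ((n.totient : ℝ) * ((((M.totient + 1) * A : ℕ) : ℝ) * B)) :=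
        mul_le_mul h2 h1 (Real.sqrt_nonneg _) (by positivity)
    _ = ((((M.totient + 1) * A : ℕ) : ℝ) * B) * (n.totient : ℝ) ^ 2 := by ring
    _ ≤ _ := mul_le_mul_of_nonneg_right h3 (by positivity)

theorem condNum_vandermonde_five_primes (p q r s t a b c d e : ℕ)
    (hp : Nat.Prime p) (hq : Nat.Prime q) (hr : Nat.Prime r) (hs : Nat.Prime s)
    (ht : Nat.Prime t)
    (hpq : p < q) (hqr : q < r) (hrs : r < s) (hst : s < t)
    (ha : 1 ≤ a) (hb : 1 ≤ b) (hc : 1 ≤ c) (hd : 1 ≤ d) (he : 1 ≤ e)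
    (n : ℕ) (hn : n = p ^ a * q ^ b * r ^ c * s ^ d * t ^ e)
    (ζ : Fin n.totient → ℂ) (hζ : ∀ i, IsPrimitiveRoot (ζ i) n)
    (hinj : Function.Injective ζ) :
    condNum (Matrix.of fun i j : Fin n.totient => ζ i ^ (j : ℕ)) ≤
      4 * ((p * q * r * s * t).totient : ℝ) ^ 7 * (n.totient : ℝ) ^ 2 := by
  exact main_aux p q r s t a b c d e hp hq hr hs ht hpq hqr hrs hst ha hb hc hd he n hn ζ hζ hinj
end

section
/- Let n = p^a q^b r^c s^d t^e u^f with p < q < r < s < t < u distinct primes and a, b, c, d, e, f ≥ 1, and set m = φ(n). Then Cond(V_{Φ_n}) ≤ 4 · φ(rad(n))¹¹ · m². -/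
section helpers
open Polynomial

/-- sum of absolute values of the coefficients -/
noncomputable def lone (f : ℤ[X]) : ℝ := ∑ i ∈ f.support, |(f.coeff i : ℝ)|

lemma lone_eq (f : ℤ[X]) (s : Finset ℕ) (h : f.support ⊆ s) :
    lone f = ∑ i ∈ s, |(f.coeff i : ℝ)| := by
  unfold lone
  apply Finset.sum_subset h
  intro i _ hi
  simp [notMem_support_iff.mp hi]

lemma lone_nonneg (f : ℤ[X]) : 0 ≤ lone f := Finset.sum_nonneg fun _ _ => abs_nonneg _

lemma sum_le_lone (f : ℤ[X]) (s : Finset ℕ) : ∑ i ∈ s, |(f.coeff i : ℝ)| ≤ lone f := by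
  rw [lone_eq f (s ∪ f.support) Finset.subset_union_right]
  exact Finset.sum_le_sum_of_subset_of_nonneg Finset.subset_union_left fun _ _ _ => abs_nonneg _

lemma lone_add (f g : ℤ[X]) : lone (f + g) ≤ lone f + lone g := by
  rw [lone_eq f (f.support ∪ g.support) Finset.subset_union_left,
    lone_eq g (f.support ∪ g.support) Finset.subset_union_right,
    lone_eq (f + g) (f.support ∪ g.support) support_add, ← Finset.sum_add_distrib]
  refine Finset.sum_le_sum fun i _ => ?_
  rw [coeff_add]; push_cast
  exact abs_add_le _ _

lemma lone_monomial_mul (n : ℕ) (a : ℤ) (g : ℤ[X]) :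
    lone (monomial n a * g) ≤ |(a : ℝ)| * lone g := by
  rw [lone_eq (monomial n a * g) (g.support.map (addRightEmbedding n))]
  · rw [Finset.sum_map]
    simp only [addRightEmbedding_apply, coeff_monomial_mul]
    unfold lone
    rw [Finset.mul_sum]
    refine Finset.sum_le_sum fun i _ => ?_
    push_cast
    rw [abs_mul]
  · intro i hi
    rw [mem_support_iff] at hi
    rw [← C_mul_X_pow_eq_monomial, mul_assoc, coeff_C_mul, coeff_X_pow_mul'] at hi
    simp only [Finset.mem_map, mem_support_iff, addRightEmbedding_apply]
    split_ifs at hi with h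
    · exact ⟨i - n, fun h' => hi (by simp [h']), by omega⟩
    · simp at hi

lemma lone_sum {ι : Type*} (s : Finset ι) (f : ι → ℤ[X]) :
    lone (∑ i ∈ s, f i) ≤ ∑ i ∈ s, lone (f i) := by
  classical
  induction s using Finset.induction_on with
  | empty => simp [lone]
  | insert a s ha ih =>
    rw [Finset.sum_insert ha, Finset.sum_insert ha]
    exact (lone_add _ _).trans (by gcongr)

lemma lone_mul (f g : ℤ[X]) : lone (f * g) ≤ lone f * lone g := by
  conv_lhs => rw [f.as_sum_support, Finset.sum_mul]
  refine (lone_sum _ _).trans ?_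
  unfold lone
  rw [Finset.sum_mul]
  exact Finset.sum_le_sum fun i _ => lone_monomial_mul _ _ _

lemma lone_expand (p : ℕ) (f : ℤ[X]) (hp : 0 < p) : lone (expand ℤ p f) ≤ lone f := by
  conv_lhs => rw [f.as_sum_support, map_sum]
  refine (lone_sum _ _).trans ?_
  unfold lone
  refine Finset.sum_le_sum fun i _ => ?_
  rw [expand_monomial]
  have := lone_monomial_mul (i * p) (f.coeff i) 1
  rw [mul_one] at this
  refine this.trans (le_of_eq ?_)
  unfold lone
  have : (1 : ℤ[X]).support = {0} := by
    ext i; simp [coeff_one]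
  rw [this]; simp

/-- height of a product -/
lemma height_mul (f g : ℤ[X]) (H : ℝ) (hf : ∀ i, |(f.coeff i : ℝ)| ≤ H) (n : ℕ) :
    |((f * g).coeff n : ℝ)| ≤ H * lone g := by
  have hH : 0 ≤ H := (abs_nonneg _).trans (hf 0)
  rw [coeff_mul]
  push_cast
  refine (Finset.abs_sum_le_sum_abs _ _).trans ?_
  rw [Finset.Nat.sum_antidiagonal_eq_sum_range_succ_mk, ← Finset.sum_range_reflect]
  refine le_trans ?_ (mul_le_mul_of_nonneg_left (sum_le_lone g (Finset.range (n+1))) hH)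
  rw [Finset.mul_sum]
  refine Finset.sum_le_sum fun i hi => ?_
  rw [Finset.mem_range] at hi
  rw [abs_mul]
  have : n - (n + 1 - 1 - i) = i := by omega
  simp only [Nat.succ_eq_add_one, this]
  gcongr
  exact hf _

/-- height of `Φ(x^p) ∑_j x^{Nj}` -/
lemma height_W (f : ℤ[X]) (N p K : ℕ) (hN : f.natDegree < N) (hcop : Nat.Coprime p N) (H : ℝ)
    (hf : ∀ i, |(f.coeff i : ℝ)| ≤ H) (n : ℕ) :
    |((expand ℤ p f * ∑ j ∈ Finset.range K, X ^ (N * j)).coeff n : ℝ)| ≤ H := by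
  have hH : 0 ≤ H := (abs_nonneg _).trans (hf 0)
  have e : expand ℤ p f * ∑ j ∈ Finset.range K, X ^ (N * j) =
      ∑ x ∈ Finset.range N ×ˢ Finset.range K, C (f.coeff x.1) * X ^ (p * x.1 + N * x.2) := by
    conv_lhs => rw [f.as_sum_range' N hN]
    rw [map_sum, Finset.sum_mul_sum, Finset.sum_product]
    refine Finset.sum_congr rfl fun i _ => Finset.sum_congr rfl fun j _ => ?_
    rw [expand_monomial, ← C_mul_X_pow_eq_monomial, mul_assoc, ← pow_add, mul_comm i p]
  rw [e, finsetSum_coeff]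
  simp only [coeff_C_mul, coeff_X_pow, mul_ite, mul_one, mul_zero]
  by_cases h : ∃ x ∈ Finset.range N ×ˢ Finset.range K, n = p * x.1 + N * x.2
  · obtain ⟨x, hx, hn⟩ := h
    rw [Finset.sum_eq_single_of_mem x hx, if_pos hn]
    · exact hf _
    · intro y hy hyx
      rw [if_neg]
      intro hn'
      apply hyx
      simp only [Finset.mem_product, Finset.mem_range] at hx hy
      have h0 : p * y.1 + N * y.2 = p * x.1 + N * x.2 := by omega
      have h1 : p * y.1 ≡ p * x.1 [MOD N] := by
        have := congrArg (· % N) h0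
        simpa [Nat.ModEq, Nat.add_mul_mod_self_left] using this
      have h2 : y.1 ≡ x.1 [MOD N] :=
        Nat.ModEq.cancel_left_of_coprime (by rw [Nat.gcd_comm]; exact hcop) h1
      have h3 : y.1 = x.1 := Nat.ModEq.eq_of_lt_of_lt h2 hy.1 hx.1
      rw [h3] at h0
      have h4 : y.2 = x.2 := Nat.eq_of_mul_eq_mul_left (by omega) (Nat.add_left_cancel h0)
      exact Prod.ext h3 h4
  · rw [Finset.sum_eq_zero]
    · simpa using hH
    · intro x hx
      rw [if_neg]
      exact fun hn => h ⟨x, hx, hn⟩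

structure CycInv (N : ℕ) (H T G : ℝ) : Prop where
  two : 2 ≤ N
  height : ∀ i, |((cyclotomic N ℤ).coeff i : ℝ)| ≤ H
  inv : ∃ Ψ : ℤ[X], Ψ * cyclotomic N ℤ = X ^ N - 1 ∧ lone Ψ ≤ T
  der : ∀ ω : ℂ, IsPrimitiveRoot ω N → 1 ≤ G * ‖(derivative (cyclotomic N ℂ)).eval ω‖
  gnn : 0 ≤ G

lemma CycInv.lone_le {N : ℕ} {H T G : ℝ} (h : CycInv N H T G) : lone (cyclotomic N ℤ) ≤ N * H := by
  have hs : (cyclotomic N ℤ).support ⊆ Finset.range N := by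
    intro i hi
    have := le_natDegree_of_mem_supp i hi
    rw [natDegree_cyclotomic] at this
    have := Nat.totient_lt N h.two
    simp; omega
  rw [lone_eq _ _ hs]
  refine (Finset.sum_le_sum fun i _ => h.height i).trans ?_
  simp

lemma norm_eval_le (f : ℤ[X]) (z : ℂ) (hz : ‖z‖ = 1) :
    ‖(f.map (Int.castRingHom ℂ)).eval z‖ ≤ lone f := by
  rw [eval_map, eval₂_eq_sum, Polynomial.sum]
  refine (norm_sum_le _ _).trans ?_
  unfold lone
  refine Finset.sum_le_sum fun i _ => ?_
  simp [hz]

lemma CycInv.step {N : ℕ} {H T G : ℝ} (h : CycInv N H T G) (p : ℕ) (hp : p.Prime) (hpN : ¬ p ∣ N) :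
    CycInv (N * p) (H * T) (T * (N * H)) (G * (N * H) / p) := by
  have hH : 0 ≤ H := (abs_nonneg _).trans (h.height 0)
  have hp0 : (0:ℝ) < p := by exact_mod_cast hp.pos
  have hN2 := h.two
  have hS := h.lone_le
  obtain ⟨Ψ, hΨ, hT⟩ := h.inv
  have hT0 : 0 ≤ T := (lone_nonneg _).trans hT
  have hex := cyclotomic_expand_eq_cyclotomic_mul hp hpN ℤ
  refine ⟨?_, ?_, ⟨expand ℤ p Ψ * cyclotomic N ℤ, ?_, ?_⟩, ?_, ?_⟩
  · nlinarith [hp.two_le]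
  · intro n
    set K := (cyclotomic (N * p) ℤ).natDegree + n + 1 with hK
    have key : cyclotomic (N * p) ℤ * (X ^ (N * K) - 1) =
        (expand ℤ p (cyclotomic N ℤ) * ∑ j ∈ Finset.range K, X ^ (N * j)) * Ψ := by
      have hg : (X ^ (N * K) - 1 : ℤ[X]) = (∑ j ∈ Finset.range K, X ^ (N * j)) * (X ^ N - 1) := by
        simp_rw [pow_mul]
        rw [geom_sum_mul]
      rw [hg, ← hΨ, hex]; ring
    have hc := congrArg (fun f => coeff f n) key
    simp only [mul_sub, mul_one, coeff_sub, coeff_mul_X_pow'] at hc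
    rw [if_neg (by nlinarith)] at hc
    have h1 := height_mul (expand ℤ p (cyclotomic N ℤ) * ∑ j ∈ Finset.range K, X ^ (N * j)) Ψ H
      (height_W _ N p K (by rw [natDegree_cyclotomic]; exact Nat.totient_lt N hN2)
        ((Nat.Prime.coprime_iff_not_dvd hp).2 hpN) H h.height) n
    rw [← hc] at h1
    rw [zero_sub] at h1
    push_cast at h1
    rw [abs_neg] at h1
    exact h1.trans (mul_le_mul_of_nonneg_left hT hH)
  · rw [mul_assoc, mul_comm (cyclotomic N ℤ), ← hex, ← map_mul, hΨ]
    simp [← pow_mul, mul_comm]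
  · exact (lone_mul _ _).trans
      (mul_le_mul ((lone_expand p Ψ hp.pos).trans hT) hS (lone_nonneg _) hT0)
  · intro ω hω
    have hex' := cyclotomic_expand_eq_cyclotomic_mul hp hpN ℂ
    have hd := congrArg (fun f => (derivative f).eval ω) hex'
    have hN0 : N * p ≠ 0 := mul_ne_zero (by omega) hp.ne_zero
    have hroot : (cyclotomic (N * p) ℂ).eval ω = 0 := by
      have : NeZero ((N * p : ℕ) : ℂ) := ⟨by exact_mod_cast hN0⟩
      exact (isRoot_cyclotomic_iff.2 hω)
    simp only [derivative_expand, derivative_mul, eval_add, eval_mul, hroot, zero_mul, add_zero,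
      expand_eval, eval_pow, eval_X, eval_natCast] at hd
    have hω1 : ‖ω‖ = 1 := hω.norm'_eq_one hN0
    have h2 := congrArg norm hd
    simp only [norm_mul, norm_pow, hω1, one_pow, mul_one, Complex.norm_natCast] at h2
    have h3 := h.der (ω ^ p) (hω.pow (Nat.pos_of_ne_zero hN0) (mul_comm _ _))
    have h4 := norm_eval_le (cyclotomic N ℤ) ω hω1
    rw [map_cyclotomic] at h4
    have h5 := h4.trans hS
    have hG := h.gnn
    set A := ‖eval (ω ^ p) (derivative (cyclotomic N ℂ))‖
    set B := ‖eval ω (derivative (cyclotomic (N * p) ℂ))‖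
    have h6 : A ≤ B * (N * H) / p := by
      rw [le_div_iff₀ hp0]
      have : B * ‖eval ω (cyclotomic N ℂ)‖ ≤ B * (N * H) :=
        mul_le_mul_of_nonneg_left h5 (norm_nonneg _)
      linarith
    calc (1:ℝ) ≤ G * A := h3
      _ ≤ G * (B * (N * H) / p) := mul_le_mul_of_nonneg_left h6 hG
      _ = _ := by ring
  · have := h.gnn
    positivity

lemma CycInv.base (p : ℕ) (hp : p.Prime) : CycInv p 1 2 (2 / p) := by
  have hp0 : (0:ℝ) < p := by exact_mod_cast hp.pos
  haveI := Fact.mk hp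
  refine ⟨hp.two_le, ?_, ⟨X - 1, ?_, ?_⟩, ?_, by positivity⟩
  · intro i
    rw [cyclotomic_prime, finsetSum_coeff]
    simp only [coeff_X_pow]
    rw [Finset.sum_ite_eq]
    split_ifs <;> simp
  · rw [cyclotomic_prime, mul_geom_sum]
  · have h1 : (X - 1 : ℤ[X]) = monomial 1 1 * 1 + monomial 0 (-1) * 1 := by
      rw [← C_mul_X_pow_eq_monomial, ← C_mul_X_pow_eq_monomial]; simp; ring
    have h2 : lone 1 = 1 := by
      have : (1 : ℤ[X]).support = {0} := by
        ext i; simp [coeff_one]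
      unfold lone
      rw [this]; simp
    rw [h1]
    refine (lone_add _ _).trans ?_
    have a := lone_monomial_mul 1 1 1
    have b := lone_monomial_mul 0 (-1) 1
    rw [h2] at a b
    norm_num at a b ⊢
    linarith
  · intro ω hω
    have e : (X - 1 : ℂ[X]) * cyclotomic p ℂ = X ^ p - 1 := by
      rw [cyclotomic_prime, mul_geom_sum]
    have hroot : (cyclotomic p ℂ).eval ω = 0 := by
      have : NeZero ((p : ℕ) : ℂ) := ⟨by exact_mod_cast hp.ne_zero⟩
      exact (isRoot_cyclotomic_iff.2 hω)
    have hd := congrArg (fun f => (derivative f).eval ω) e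
    simp [derivative_mul, hroot, derivative_X_pow] at hd
    have hω1 : ‖ω‖ = 1 := hω.norm'_eq_one hp.ne_zero
    have h2 := congrArg norm hd
    simp only [norm_mul, norm_pow, hω1, one_pow, mul_one, Complex.norm_natCast] at h2
    have h3 : ‖ω - 1‖ ≤ 2 := by
      refine (norm_sub_le _ _).trans ?_
      rw [hω1]; norm_num
    rw [div_mul_eq_mul_div, le_div_iff₀ hp0]
    have := mul_le_mul_of_nonneg_right h3 (norm_nonneg (eval ω (derivative (cyclotomic p ℂ))))
    linarith

/-- the quantity controlling entries of the inverse -/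
def Ctrl (n : ℕ) (C : ℝ) : Prop :=
  ∀ ω : ℂ, IsPrimitiveRoot ω n →
    lone (cyclotomic n ℤ) ≤ C * ‖(derivative (cyclotomic n ℂ)).eval ω‖

lemma CycInv.ctrl {N : ℕ} {H T G : ℝ} (h : CycInv N H T G) : Ctrl N (N * H * G) := by
  intro ω hω
  have hH : 0 ≤ H := (abs_nonneg _).trans (h.height 0)
  have := mul_le_mul_of_nonneg_left (h.der ω hω) (by positivity : 0 ≤ N * H)
  have h2 := h.lone_le
  linarith

lemma Ctrl.mul {n : ℕ} {C : ℝ} (hC : 0 ≤ C) (hn : n ≠ 0) (h : Ctrl n C) (p : ℕ) (hp : p.Prime)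
    (hpn : p ∣ n) : Ctrl (n * p) C := by
  intro ω hω
  have e := cyclotomic_expand_eq_cyclotomic hp hpn ℂ
  have hN0 : n * p ≠ 0 := mul_ne_zero hn hp.ne_zero
  have hd := congrArg (fun f => (derivative f).eval ω) e
  simp only [derivative_expand, eval_mul,
      expand_eval, eval_pow, eval_X, eval_natCast] at hd
  have hω1 : ‖ω‖ = 1 := hω.norm'_eq_one hN0
  have h2 := congrArg norm hd
  simp only [norm_mul, norm_pow, hω1, one_pow, mul_one, Complex.norm_natCast] at h2
  rw [← h2, ← cyclotomic_expand_eq_cyclotomic hp hpn ℤ]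
  refine (lone_expand p _ hp.pos).trans ((h (ω ^ p) (hω.pow (Nat.pos_of_ne_zero hN0) (mul_comm _ _))).trans ?_)
  apply mul_le_mul_of_nonneg_left _ hC
  apply le_mul_of_one_le_right (norm_nonneg _)
  exact_mod_cast hp.one_le

lemma Ctrl.mul_pow {n : ℕ} {C : ℝ} (hC : 0 ≤ C) (hn : n ≠ 0) (h : Ctrl n C) (p : ℕ) (hp : p.Prime)
    (hpn : p ∣ n) (k : ℕ) : Ctrl (n * p ^ k) C := by
  induction k with
  | zero => simpa using h
  | succ k ih =>
    rw [pow_succ, ← mul_assoc]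
    exact Ctrl.mul hC (mul_ne_zero hn (pow_ne_zero _ hp.ne_zero)) ih p hp (Dvd.dvd.mul_right hpn _)

lemma coeff_div_le (n : ℕ) (z : ℂ) (hz : ‖z‖ = 1) (j : ℕ) :
    ‖(cyclotomic n ℂ /ₘ (X - C z)).coeff j‖ ≤ lone (cyclotomic n ℤ) := by
  rw [coeff_divByMonic_X_sub_C]
  refine (norm_sum_le _ _).trans ?_
  refine le_trans (le_of_eq ?_) (sum_le_lone (cyclotomic n ℤ) (Finset.Icc (j + 1) (cyclotomic n ℂ).natDegree))
  refine Finset.sum_congr rfl fun i _ => ?_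
  rw [norm_mul, norm_pow, hz, one_pow, one_mul, ← map_cyclotomic_int n ℂ, coeff_map]
  simp

lemma condNum_le (n : ℕ) (hn : 2 ≤ n) (K : ℝ) (hK : Ctrl n K)
    (ζ : Fin n.totient → ℂ) (hζ : ∀ i, IsPrimitiveRoot (ζ i) n)
    (hinj : Function.Injective ζ) :
    condNum (Matrix.of fun i j : Fin n.totient => ζ i ^ (j : ℕ)) ≤ K * (n.totient : ℝ) ^ 2 := by
  have hn0 : n ≠ 0 := by omega
  have hne : NeZero (n : ℂ) := ⟨by exact_mod_cast hn0⟩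
  have hm : 0 < n.totient := Nat.totient_pos.2 (by omega)
  have hroot : ∀ i, (cyclotomic n ℂ).eval (ζ i) = 0 := fun i => isRoot_cyclotomic_iff.2 (hζ i)
  have hfac : ∀ i, (X - C (ζ i)) * (cyclotomic n ℂ /ₘ (X - C (ζ i))) = cyclotomic n ℂ :=
    fun i => mul_divByMonic_eq_iff_isRoot.2 (hroot i)
  have hnorm : ∀ i, ‖ζ i‖ = 1 := fun i => (hζ i).norm'_eq_one hn0
  have hder : ∀ i, (cyclotomic n ℂ /ₘ (X - C (ζ i))).eval (ζ i) =
      (derivative (cyclotomic n ℂ)).eval (ζ i) := by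
    intro i
    conv_rhs => rw [← hfac i]
    simp [derivative_mul]
  have hder0 : ∀ i, (derivative (cyclotomic n ℂ)).eval (ζ i) ≠ 0 := by
    intro i h0
    have h1 := hK (ζ i) (hζ i)
    rw [h0, norm_zero, mul_zero] at h1
    have h2 := sum_le_lone (cyclotomic n ℤ) {0}
    rw [Finset.sum_singleton, cyclotomic_coeff_zero ℤ (by omega)] at h2
    norm_num at h2
    linarith
  set B : Matrix (Fin n.totient) (Fin n.totient) ℂ := Matrix.of fun j i =>
    (cyclotomic n ℂ /ₘ (X - C (ζ i))).coeff j / (derivative (cyclotomic n ℂ)).eval (ζ i) with hB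
  have hmul : (Matrix.of fun i j : Fin n.totient => ζ i ^ (j : ℕ)) * B = 1 := by
    ext i k
    rw [Matrix.mul_apply]
    simp only [hB, Matrix.of_apply]
    have hdeg : (cyclotomic n ℂ /ₘ (X - C (ζ k))).natDegree < n.totient := by
      rw [natDegree_divByMonic _ (monic_X_sub_C _), natDegree_cyclotomic, natDegree_X_sub_C]
      omega
    have h1 : ∑ j : Fin n.totient, ζ i ^ (j:ℕ) * ((cyclotomic n ℂ /ₘ (X - C (ζ k))).coeff j /
        (derivative (cyclotomic n ℂ)).eval (ζ k)) =
        (cyclotomic n ℂ /ₘ (X - C (ζ k))).eval (ζ i) /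
          (derivative (cyclotomic n ℂ)).eval (ζ k) := by
      rw [eval_eq_sum_range' hdeg, Finset.sum_div, Finset.sum_range]
      refine Finset.sum_congr rfl fun j _ => ?_
      ring
    rw [h1]
    by_cases hik : i = k
    · subst hik
      rw [hder, div_self (hder0 i), Matrix.one_apply_eq]
    · rw [Matrix.one_apply_ne hik]
      have h2 := congrArg (eval (ζ i)) (hfac k)
      rw [eval_mul, hroot i] at h2
      rcases mul_eq_zero.1 h2 with h3 | h3
      · exfalso
        apply hik
        apply hinj
        simpa [sub_eq_zero] using h3
      · rw [h3, zero_div]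
  have hinv : (Matrix.of fun i j : Fin n.totient => ζ i ^ (j : ℕ))⁻¹ = B :=
    Matrix.inv_eq_right_inv hmul
  have hBle : ∀ j i, ‖B j i‖ ≤ K := by
    intro j i
    simp only [hB, Matrix.of_apply, norm_div]
    rw [div_le_iff₀ (norm_pos_iff.2 (hder0 i))]
    exact (coeff_div_le n (ζ i) (hnorm i) j).trans (hK (ζ i) (hζ i))
  have hK0 : 0 ≤ K := (norm_nonneg _).trans (hBle ⟨0, hm⟩ ⟨0, hm⟩)
  have frob : ∀ (A : Matrix (Fin n.totient) (Fin n.totient) ℂ) (c : ℝ), 0 ≤ c →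
      (∀ i j, ‖A i j‖ ≤ c) → frobNorm A ≤ c * n.totient := by
    intro A c hc hA
    unfold frobNorm
    apply Real.sqrt_le_iff.2
    refine ⟨by positivity, ?_⟩
    calc ∑ i, ∑ j, ‖A i j‖ ^ 2 ≤ ∑ i : Fin n.totient, ∑ j : Fin n.totient, c ^ 2 := by
          gcongr with i _ j _
          exact hA i j
      _ = _ := by simp; ring
  unfold condNum
  rw [hinv]
  have f1 := frob (Matrix.of fun i j : Fin n.totient => ζ i ^ (j : ℕ)) 1 zero_le_one
    (by intro i j; simp [hnorm])
  have f2 := frob B K hK0 hBle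
  calc _ ≤ (1 * (n.totient:ℝ)) * (K * n.totient) := by
        apply mul_le_mul f1 f2 (Real.sqrt_nonneg _) (by positivity)
    _ = _ := by ring


/-- generic comparison -/
lemma final_gen (p q r s t u : ℝ) (lp lq lr ls lt A B D : ℝ)
    (hA : 0 < A) (hB : 0 < B) (hD : 0 < D)
    (hp1 : 1 < p) (hqr : q ≤ r) (hq1 : 1 < q) (hs1 : 1 < s) (ht1 : 1 < t) (hu1 : 1 < u)
    (hp : p ≤ lp * (p - 1)) (hq : q ≤ lq * (q - 1)) (hr : r ≤ lr * (r - 1))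
    (hs : s ≤ ls * (s - 1)) (ht : t ≤ lt * (t - 1))
    (hS : A * (p - 1) ≤ s - 1) (hT : B * (p - 1) ≤ t - 1) (hU : B * (p - 1) ≤ u - 1)
    (hU' : D ≤ u - 1)
    (hnum : 2 ^ 30 * lp ^ 31 * lq ^ 15 * lr ^ 7 * ls ^ 3 * lt ≤ A ^ 8 * B ^ 12 * D ^ 9) :
    2 ^ 32 * p ^ 31 * q ^ 15 * r ^ 7 * s ^ 3 * t ≤
      4 * ((p - 1) * (q - 1) * (r - 1) * (s - 1) * (t - 1) * (u - 1)) ^ 11 := by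
  have hr1 : 1 < r := by linarith
  have qr : q - 1 ≤ r - 1 := by linarith
  generalize hP : p - 1 = P at *
  generalize hQ : q - 1 = Q at *
  generalize hR : r - 1 = R at *
  generalize hSS : s - 1 = S at *
  generalize hTT : t - 1 = T at *
  generalize hUU : u - 1 = U at *
  have P0 : 0 < P := by linarith
  have Q0 : 0 < Q := by linarith
  have R0 : 0 < R := by linarith
  have S0 : 0 < S := by linarith
  have T0 : 0 < T := by linarith
  have U0 : 0 < U := by linarith
  have e1 : 2 ^ 32 * p ^ 31 * q ^ 15 * r ^ 7 * s ^ 3 * t ≤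
     2 ^ 32 * (lp * P) ^ 31 * (lq * Q) ^ 15 * (lr * R) ^ 7 * (ls * S) ^ 3 * (lt * T) := by
    have z1 : 0 < lp * P := by linarith
    have z2 : 0 < lq * Q := by linarith
    have z3 : 0 < lr * R := by linarith
    have z4 : 0 < ls * S := by linarith
    have z5 : 0 < lt * T := by linarith
    generalize lp * P = x1 at *
    generalize lq * Q = x2 at *
    generalize lr * R = x3 at *
    generalize ls * S = x4 at *
    generalize lt * T = x5 at *
    gcongr
  refine e1.trans ?_
  have e2 : 2 ^ 32 * (lp * P) ^ 31 * (lq * Q) ^ 15 * (lr * R) ^ 7 * (ls * S) ^ 3 * (lt * T)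
    = 4 * (2 ^ 30 * lp ^ 31 * lq ^ 15 * lr ^ 7 * ls ^ 3 * lt) *
       (P ^ 20 * Q ^ 4) * (P ^ 11 * Q ^ 11 * R ^ 7 * S ^ 3 * T) := by ring
  rw [e2]
  have e3 : (2 ^ 30 * lp ^ 31 * lq ^ 15 * lr ^ 7 * ls ^ 3 * lt) * (P ^ 20 * Q ^ 4) ≤
     R ^ 4 * S ^ 8 * T ^ 10 * U ^ 11 := by
    calc _ ≤ (A ^ 8 * B ^ 12 * D ^ 9) * (P ^ 20 * Q ^ 4) := by gcongr
      _ = Q ^ 4 * (A * P) ^ 8 * (B * P) ^ 10 * ((B * P) ^ 2 * D ^ 9) := by ring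
      _ ≤ R ^ 4 * S ^ 8 * T ^ 10 * (U ^ 2 * U ^ 9) := by gcongr
      _ = _ := by ring
  calc _ = 4 * ((2 ^ 30 * lp ^ 31 * lq ^ 15 * lr ^ 7 * ls ^ 3 * lt) * (P ^ 20 * Q ^ 4)) * (P ^ 11 * Q ^ 11 * R ^ 7 * S ^ 3 * T) := by ring
    _ ≤ 4 * (R ^ 4 * S ^ 8 * T ^ 10 * U ^ 11) * (P ^ 11 * Q ^ 11 * R ^ 7 * S ^ 3 * T) := by gcongr
    _ = _ := by ring

lemma odd_gap {a b : ℕ} (ha : a.Prime) (hb : b.Prime) (h2 : 2 < a) (h : a < b) : a + 2 ≤ b := by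
  have h1 := ha.eq_two_or_odd
  have h3 := hb.eq_two_or_odd
  omega

lemma final_ineq (p q r s t u : ℕ)
    (hp : Nat.Prime p) (hq : Nat.Prime q) (hr : Nat.Prime r) (hs : Nat.Prime s)
    (ht : Nat.Prime t) (hu : Nat.Prime u)
    (hpq : p < q) (hqr : q < r) (hrs : r < s) (hst : s < t) (htu : t < u) :
    2 ^ 32 * (p:ℝ) ^ 31 * q ^ 15 * r ^ 7 * s ^ 3 * t ≤
      4 * (((p:ℝ) - 1) * (q - 1) * (r - 1) * (s - 1) * (t - 1) * (u - 1)) ^ 11 := by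
  have p2 := hp.two_le
  have g2 := odd_gap hq hr (by omega) hqr
  have g3 := odd_gap hr hs (by omega) hrs
  have g4 := odd_gap hs ht (by omega) hst
  have g5 := odd_gap ht hu (by omega) htu
  have c : ∀ {a b : ℕ} (k : ℕ), a + k ≤ b → (a:ℝ) + k ≤ b := fun k h => by exact_mod_cast h
  have c2 : ∀ {a b : ℕ}, a + 2 ≤ b → (a:ℝ) + 2 ≤ b := fun h => by exact_mod_cast h
  have d2 := c2 g2
  have d3 := c2 g3
  have d4 := c2 g4
  have d5 := c2 g5
  have p2' : (2:ℝ) ≤ p := by exact_mod_cast p2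
  have q3' : (3:ℝ) ≤ q := by exact_mod_cast (by omega : 3 ≤ q)
  rcases Nat.lt_or_ge p 3 with h | h
  · obtain rfl : p = 2 := by omega
    have : (9:ℝ) ≤ t := by linarith
    push_cast
    refine final_gen _ _ _ _ _ _ 2 (3/2) (5/4) (7/6) (9/8) 6 8 10 ?_ ?_ ?_ ?_ ?_ ?_ ?_ ?_ ?_ ?_ ?_ ?_ ?_ ?_ ?_ ?_ ?_ ?_ ?_ <;>
      linarith
  have g1 := odd_gap hp hq (by omega) hpq
  have d1 := c2 g1
  have p3' : (3:ℝ) ≤ p := by exact_mod_cast h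
  rcases Nat.lt_or_ge p 11 with h' | h'
  · have : p = 3 ∨ p = 5 ∨ p = 7 := by
      interval_cases p <;> first | omega | (revert hp; norm_num)
    rcases this with rfl | rfl | rfl
    · push_cast at *
      refine final_gen _ _ _ _ _ _ (3/2) (5/4) (7/6) (9/8) (11/10) 4 5 12 ?_ ?_ ?_ ?_ ?_ ?_ ?_ ?_ ?_ ?_ ?_ ?_ ?_ ?_ ?_ ?_ ?_ ?_ ?_ <;>
      linarith
    · push_cast at *
      refine final_gen _ _ _ _ _ _ (5/4) (7/6) (9/8) (11/10) (13/12) (5/2) 3 14 ?_ ?_ ?_ ?_ ?_ ?_ ?_ ?_ ?_ ?_ ?_ ?_ ?_ ?_ ?_ ?_ ?_ ?_ ?_ <;>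
      linarith
    · push_cast at *
      refine final_gen _ _ _ _ _ _ (7/6) (9/8) (11/10) (13/12) (15/14) 2 2 16 ?_ ?_ ?_ ?_ ?_ ?_ ?_ ?_ ?_ ?_ ?_ ?_ ?_ ?_ ?_ ?_ ?_ ?_ ?_ <;>
      linarith
  · have p11 : (11:ℝ) ≤ p := by exact_mod_cast h'
    refine final_gen _ _ _ _ _ _ (11/10) (13/12) (15/14) (17/16) (19/18) 1 1 20 ?_ ?_ ?_ ?_ ?_ ?_ ?_ ?_ ?_ ?_ ?_ ?_ ?_ ?_ ?_ ?_ ?_ ?_ ?_ <;>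
      linarith

end helpers

theorem condNum_vandermonde_six_primes (p q r s t u a b c d e f : ℕ)
    (hp : Nat.Prime p) (hq : Nat.Prime q) (hr : Nat.Prime r) (hs : Nat.Prime s)
    (ht : Nat.Prime t) (hu : Nat.Prime u)
    (hpq : p < q) (hqr : q < r) (hrs : r < s) (hst : s < t) (htu : t < u)
    (ha : 1 ≤ a) (hb : 1 ≤ b) (hc : 1 ≤ c) (hd : 1 ≤ d) (he : 1 ≤ e) (hf : 1 ≤ f)
    (n : ℕ) (hn : n = p ^ a * q ^ b * r ^ c * s ^ d * t ^ e * u ^ f)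
    (ζ : Fin n.totient → ℂ) (hζ : ∀ i, IsPrimitiveRoot (ζ i) n)
    (hinj : Function.Injective ζ) :
    condNum (Matrix.of fun i j : Fin n.totient => ζ i ^ (j : ℕ)) ≤
      4 * ((p * q * r * s * t * u).totient : ℝ) ^ 11 * (n.totient : ℝ) ^ 2 := by
  have nd : ∀ {x y : ℕ}, x.Prime → y.Prime → x < y → ¬ y ∣ x := fun hx _ h h' =>
    absurd (Nat.le_of_dvd hx.pos h') (by omega)
  have cop : ∀ {x y : ℕ}, x.Prime → y.Prime → x < y → Nat.Coprime x y := fun hx hy h =>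
    (Nat.coprime_primes hx hy).2 (by omega)
  have n2 : ¬ q ∣ p := nd hp hq hpq
  have n3 : ¬ r ∣ p * q := by
    simp only [hr.dvd_mul, not_or]
    exact ⟨nd hp hr (by omega), nd hq hr (by omega)⟩
  have n4 : ¬ s ∣ p * q * r := by
    simp only [hs.dvd_mul, not_or]
    exact ⟨⟨nd hp hs (by omega), nd hq hs (by omega)⟩, nd hr hs (by omega)⟩
  have n5 : ¬ t ∣ p * q * r * s := by
    simp only [ht.dvd_mul, not_or]
    exact ⟨⟨⟨nd hp ht (by omega), nd hq ht (by omega)⟩, nd hr ht (by omega)⟩, nd hs ht (by omega)⟩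
  have n6 : ¬ u ∣ p * q * r * s * t := by
    simp only [hu.dvd_mul, not_or]
    exact ⟨⟨⟨⟨nd hp hu (by omega), nd hq hu (by omega)⟩, nd hr hu (by omega)⟩,
      nd hs hu (by omega)⟩, nd ht hu (by omega)⟩
  have tot : ((p * q * r * s * t * u).totient : ℝ) =
      ((p:ℝ) - 1) * (q - 1) * (r - 1) * (s - 1) * (t - 1) * (u - 1) := by
    rw [Nat.totient_mul ((hu.coprime_iff_not_dvd.2 n6).symm),
      Nat.totient_mul ((ht.coprime_iff_not_dvd.2 n5).symm),
      Nat.totient_mul ((hs.coprime_iff_not_dvd.2 n4).symm),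
      Nat.totient_mul ((hr.coprime_iff_not_dvd.2 n3).symm),
      Nat.totient_mul ((hq.coprime_iff_not_dvd.2 n2).symm),
      Nat.totient_prime hp, Nat.totient_prime hq, Nat.totient_prime hr, Nat.totient_prime hs,
      Nat.totient_prime ht, Nat.totient_prime hu]
    push_cast [Nat.cast_sub hp.one_le, Nat.cast_sub hq.one_le, Nat.cast_sub hr.one_le,
      Nat.cast_sub hs.one_le, Nat.cast_sub ht.one_le, Nat.cast_sub hu.one_le]
    rfl
  have inv6 := (((((CycInv.base p hp).step q hq n2).step r hr n3).step s hs n4).step t ht n5).step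
    u hu n6
  have hctrl := inv6.ctrl
  have p0 := hp.ne_zero
  have q0 := hq.ne_zero
  have r0 := hr.ne_zero
  have s0 := hs.ne_zero
  have t0 := ht.ne_zero
  have u0 := hu.ne_zero
  have hctrl2 : Ctrl (p * q * r * s * t * u)
      (2 ^ 32 * (p:ℝ) ^ 31 * q ^ 15 * r ^ 7 * s ^ 3 * t) := by
    convert hctrl using 1
    have : (p:ℝ) ≠ 0 := by exact_mod_cast p0
    have : (q:ℝ) ≠ 0 := by exact_mod_cast q0
    have : (r:ℝ) ≠ 0 := by exact_mod_cast r0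
    have : (s:ℝ) ≠ 0 := by exact_mod_cast s0
    have : (t:ℝ) ≠ 0 := by exact_mod_cast t0
    have : (u:ℝ) ≠ 0 := by exact_mod_cast u0
    push_cast
    field_simp
  have hfin := final_ineq p q r s t u hp hq hr hs ht hu hpq hqr hrs hst htu
  rw [← tot] at hfin
  have hK : Ctrl (p * q * r * s * t * u) (4 * ((p * q * r * s * t * u).totient : ℝ) ^ 11) :=
    fun ω hω => (hctrl2 ω hω).trans (mul_le_mul_of_nonneg_right hfin (norm_nonneg _))
  have hC0 : (0:ℝ) ≤ 4 * ((p * q * r * s * t * u).totient : ℝ) ^ 11 := by positivity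
  generalize 4 * ((p * q * r * s * t * u).totient : ℝ) ^ 11 = K at *
  obtain ⟨a, rfl⟩ := Nat.exists_eq_add_of_le ha
  obtain ⟨b, rfl⟩ := Nat.exists_eq_add_of_le hb
  obtain ⟨c, rfl⟩ := Nat.exists_eq_add_of_le hc
  obtain ⟨d, rfl⟩ := Nat.exists_eq_add_of_le hd
  obtain ⟨e, rfl⟩ := Nat.exists_eq_add_of_le he
  obtain ⟨f, rfl⟩ := Nat.exists_eq_add_of_le hf
  have k1 := hK.mul_pow hC0 (by positivity) p hp ⟨q * r * s * t * u, by ring⟩ a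
  have k2 := k1.mul_pow hC0 (by positivity) q hq ⟨p * r * s * t * u * p ^ a, by ring⟩ b
  have k3 := k2.mul_pow hC0 (by positivity) r hr ⟨p * q * s * t * u * p ^ a * q ^ b, by ring⟩ c
  have k4 := k3.mul_pow hC0 (by positivity) s hs
    ⟨p * q * r * t * u * p ^ a * q ^ b * r ^ c, by ring⟩ d
  have k5 := k4.mul_pow hC0 (by positivity) t ht
    ⟨p * q * r * s * u * p ^ a * q ^ b * r ^ c * s ^ d, by ring⟩ e
  have k6 := k5.mul_pow hC0 (by positivity) u hu
    ⟨p * q * r * s * t * p ^ a * q ^ b * r ^ c * s ^ d * t ^ e, by ring⟩ f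
  have hn' : n = p * q * r * s * t * u * p ^ a * q ^ b * r ^ c * s ^ d * t ^ e * u ^ f := by
    rw [hn]; ring
  rw [← hn'] at k6
  have hn2 : 2 ≤ n := by
    refine hp.two_le.trans (Nat.le_of_dvd ?_ ?_)
    · rw [hn']; positivity
    · rw [hn']
      exact ⟨q * r * s * t * u * p ^ a * q ^ b * r ^ c * s ^ d * t ^ e * u ^ f, by ring⟩
  exact condNum_le n hn2 K k6 ζ hζ hinj
end
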